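/- Let B be a Brown algebra over a field F of characteristic not 2 or 3. Then every proper inner ideal of B has F-dimension at most 12. Moreover, if F is separably closed and B = B(J^d,F×F) with associated triple system (b,t), then for every 12-dimensional proper inner ideal I there exist an isometry f of (B,b,t) and a rank-one element d ∈ J^d with f(I) = {(α, ξ·d; d×k, 0) : α, ξ ∈ F, k ∈ J^d}. -/

import Mathlib

set_option synthInstance.maxHeartbeats 1000000
set_option maxHeartbeats 1000000

noncomputable section

open scoped TensorProduct

universe u v

structure OctonionAlgebra (F : Type u) [Field F] : Type (max u (v + 1)) where
  C : Type v
  [ringC : NonAssocRing C]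
  [modC : Module F C]
  [sccC : SMulCommClass F C C]
  [istC : IsScalarTower F C C]
  n : QuadraticForm F C
  finrank_eq : Module.finrank F C = 8
  nondeg : ∀ x : C, (∀ y : C, QuadraticMap.polar (⇑n) x y = 0) → x = 0
  n_one : n 1 = 1
  n_mul : ∀ x y : C, n (x * y) = n x * n y

attribute [instance] OctonionAlgebra.ringC OctonionAlgebra.modC OctonionAlgebra.sccC
  OctonionAlgebra.istC

namespace OctonionAlgebra

variable {F : Type u} [Field F] (O : OctonionAlgebra.{u, v} F)

/-- Conjugation `x̄ := n(x,1)•1 - x` (bundled as a linear map; `polarBilin n x 1 = n(x,1)`). -/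
def conj : O.C →ₗ[F] O.C :=
  (LinearMap.toSpanSingleton F O.C (1 : O.C)).comp ((QuadraticMap.polarBilin O.n).flip 1)
    - LinearMap.id

lemma conj_apply (x : O.C) :
    O.conj x = QuadraticMap.polar (⇑O.n) x 1 • (1 : O.C) - x := rfl

/-- A split octonion algebra: the norm form is isotropic. -/
def IsSplit : Prop := ∃ x : O.C, x ≠ 0 ∧ O.n x = 0

end OctonionAlgebra

/-- A reduced Albert algebra `H₃(C,γ)`. -/
structure ReducedAlbert (F : Type u) [Field F] : Type (max u (v + 1)) where
  O : OctonionAlgebra.{u, v} F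
  γ : Fin 3 → Fˣ

namespace ReducedAlbert

variable {F : Type u} [Field F] (A : ReducedAlbert.{u, v} F)

/-- The ambient space of 3×3 matrices over the octonion algebra. -/
abbrev M : Type v := Matrix (Fin 3) (Fin 3) A.O.C

/-- The 27-dimensional space `H₃(C,γ)` of `γ`-hermitian matrices:
`x = γ⁻¹ ⬝ (x̄)ᵀ ⬝ γ`, i.e. entrywise `x i j = γᵢ⁻¹ γⱼ • conj (x j i)`. -/
def J : Submodule F A.M where
  carrier := {x | ∀ i j, x i j = ((A.γ i : F)⁻¹ * (A.γ j : F)) • A.O.conj (x j i)}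
  add_mem' := by
    intro a b ha hb i j
    show a i j + b i j = ((A.γ i : F)⁻¹ * (A.γ j : F)) • A.O.conj (a j i + b j i)
    rw [map_add, smul_add, ← ha i j, ← hb i j]
  zero_mem' := by
    intro i j
    show (0 : A.O.C) = ((A.γ i : F)⁻¹ * (A.γ j : F)) • A.O.conj (0 : A.O.C)
    rw [map_zero, smul_zero]
  smul_mem' := by
    intro c a ha i j
    show c • a i j = ((A.γ i : F)⁻¹ * (A.γ j : F)) • A.O.conj (c • a j i)
    rw [map_smul, smul_comm, ← ha i j]

/-- The Jordan product `x·y := (xy + yx)/2`. -/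
def jmul (x y : A.M) : A.M := (2 : F)⁻¹ • (x * y + y * x)

/-- The trace `T(x)`: the sum of the diagonal entries, which for hermitian matrices are
scalars `ε•1`; the scalar `ε` is recovered as `n(ε•1, 1)/2`. -/
def trace (x : A.M) : F := (2 : F)⁻¹ * ∑ i, QuadraticMap.polar (⇑A.O.n) (x i i) 1

/-- The trace bilinear form `T(x,y) := T(x·y)`. -/
def tb (x y : A.M) : F := A.trace (A.jmul x y)

/-- The adjoint `x ^ # = x·x − T(x)·x + ½(T(x)² − T(x,x))·1`, the unique quadratic map such
that `T(x^#, y)` is the coefficient of `s` in `N(x + s y)`. -/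
def sharp (x : A.M) : A.M :=
  A.jmul x x - A.trace x • x + ((2 : F)⁻¹ * (A.trace x ^ 2 - A.tb x x)) • (1 : A.M)

/-- The Freudenthal cross product `x × y := (x+y)^# − x^# − y^#`. -/
def cross (x y : A.M) : A.M := A.sharp (x + y) - A.sharp x - A.sharp y

/-- The cubic norm `N`, defined pointwise on `J` by
`N(x)·1 = x·(x·x) − T(x)·(x·x) + ½(T(x)² − T(x,x))·x`; the scalar is recovered by
applying the trace (which takes value `3` on `1`). -/
def norm (x : A.M) : F :=
  (3 : F)⁻¹ * A.trace (A.jmul x (A.jmul x x) - A.trace x • A.jmul x x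
    + ((2 : F)⁻¹ * (A.trace x ^ 2 - A.tb x x)) • x)

/-- The operator `⟨x,y⟩(j) := ½ (y × (x × j) − T(j,y)·x − ⅓·T(x,y)·j)`. -/
def brok (x y j : A.M) : A.M :=
  (2 : F)⁻¹ • (A.cross y (A.cross x j) - A.tb j y • x - ((3 : F)⁻¹ * A.tb x y) • j)

/-- `A` is the split Albert algebra `H₃(Cᵈ, 1)`. -/
def IsSplitAlbert : Prop := A.O.IsSplit ∧ ∀ i, A.γ i = 1

/-- A point of `H₃(C,γ)` with coordinates `(ε₀,ε₁,ε₂; a,b,c)`. -/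
def elt (ε : Fin 3 → F) (a b c : A.O.C) : A.M :=
  Matrix.of
    ![![ε 0 • (1 : A.O.C), c, ((A.γ 0 : F)⁻¹ * (A.γ 2 : F)) • A.O.conj b],
      ![((A.γ 1 : F)⁻¹ * (A.γ 0 : F)) • A.O.conj c, ε 1 • (1 : A.O.C), a],
      ![b, ((A.γ 2 : F)⁻¹ * (A.γ 1 : F)) • A.O.conj a, ε 2 • (1 : A.O.C)]]

/-! ### The Brown algebra `B(J, F×F, ζ)` -/

/-- Ambient space of the Brown algebra `B(J, F×F, ζ)`: elements `(α, j; j', β)`. -/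
abbrev Bam : Type (max u v) := F × A.M × A.M × F

/-- The underlying 56-dimensional space of `B(J, F×F, ζ)`: both middle components lie in `J`. -/
def Bsub : Submodule F A.Bam where
  carrier := {p | p.2.1 ∈ A.J ∧ p.2.2.1 ∈ A.J}
  add_mem' := fun ha hb => ⟨A.J.add_mem ha.1 hb.1, A.J.add_mem ha.2 hb.2⟩
  zero_mem' := ⟨A.J.zero_mem, A.J.zero_mem⟩
  smul_mem' := fun c _ h => ⟨A.J.smul_mem c h.1, A.J.smul_mem c h.2⟩

/-- The product of `B(J, F×F, ζ)`. -/
def bmul (ζ : F) (x y : A.Bam) : A.Bam :=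
  (x.1 * y.1 + ζ * A.tb x.2.1 y.2.2.1,
   x.1 • y.2.1 + y.2.2.2 • x.2.1 + ζ • A.cross x.2.2.1 y.2.2.1,
   y.1 • x.2.2.1 + x.2.2.2 • y.2.2.1 + A.cross x.2.1 y.2.1,
   x.2.2.2 * y.2.2.2 + ζ * A.tb y.2.1 x.2.2.1)

/-- The involution `(α,j;j',β)‾ = (β,j;j',α)` of `B(J, F×F, ζ)`. -/
def binv (x : A.Bam) : A.Bam := (x.2.2.2, x.2.1, x.2.2.1, x.1)

/-- The skew-symmetric element `s₀ = (1,0;0,−1)`. -/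
def s0 : A.Bam := (1, 0, 0, -1)

/-- The triple product `{x,y,z} := (x·ȳ)·z + (z·ȳ)·x − (z·x̄)·y` in `B(J, F×F, ζ)`. -/
def brace (ζ : F) (x y z : A.Bam) : A.Bam :=
  A.bmul ζ (A.bmul ζ x (A.binv y)) z + A.bmul ζ (A.bmul ζ z (A.binv y)) x
    - A.bmul ζ (A.bmul ζ z (A.binv x)) y

/-- The bilinear form of the triple system associated to `B(J, F×F, ζ)` and a skew element
`s`: `b(x,y)` is the unique scalar with `b(x,y)•1 = (x·ȳ − y·x̄)·s`; since the unit of the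
algebra is `(1,0;0,1)`, it is the first component of the right-hand side. -/
def bformS (ζ : F) (s x y : A.Bam) : F :=
  (A.bmul ζ (A.bmul ζ x (A.binv y) - A.bmul ζ y (A.binv x)) s).1

/-- The trilinear product of the triple system associated to `B(J, F×F, ζ)` and `s`:
`t(y,z,w) := 2{y, s·z, w} − b(z,w)·y − b(z,y)·w − b(y,w)·z`. -/
def tformS (ζ : F) (s y z w : A.Bam) : A.Bam :=
  (2 : F) • A.brace ζ y (A.bmul ζ s z) w - A.bformS ζ s z w • y - A.bformS ζ s z y • w
    - A.bformS ζ s y w • z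

/-- The bilinear form of the triple system associated to `B(J, F×F, ζ)` and `s₀`. -/
def bform (ζ : F) (x y : A.Bam) : F := A.bformS ζ A.s0 x y

/-- The trilinear product of the triple system associated to `B(J, F×F, ζ)` and `s₀`. -/
def tform (ζ : F) (y z w : A.Bam) : A.Bam := A.tformS ζ A.s0 y z w

/-- `e` is a singular element of `B(J, F×F, ζ)`: `e ≠ 0` and `U_e(B) ⊆ F·e`
where `U_e(x) := {e,x,e}`. -/
def IsSingular (ζ : F) (e : A.Bam) : Prop :=
  e ≠ 0 ∧ ∀ x ∈ A.Bsub, ∃ c : F, A.brace ζ e x e = c • e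

/-- `I` is an inner ideal of `B(J, F×F, ζ)`: a subspace of `B` with `U_e(B) ⊆ I`
for all `e ∈ I`. -/
def IsInnerIdeal (ζ : F) (I : Submodule F A.Bam) : Prop :=
  I ≤ A.Bsub ∧ ∀ e ∈ I, ∀ x ∈ A.Bsub, A.brace ζ e x e ∈ I

end ReducedAlbert

/-- The separable closure of `F` (inside an algebraic closure). -/
abbrev Fsep (F : Type u) [Field F] : Type u :=
  ↥(separableClosure F (AlgebraicClosure F))

/-- A Brown algebra over `F`: a 56-dimensional `F`-algebra with `F`-linear involution which
becomes isomorphic to the split Brown algebra `B(Jᵈ, K×K)` after base change to the separable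
closure `K` of `F`. -/
structure BrownAlgebra (F : Type u) [Field F] : Type (u + 1) where
  B : Type u
  [ringB : NonAssocRing B]
  [modB : Module F B]
  [sccB : SMulCommClass F B B]
  [istB : IsScalarTower F B B]
  ι : B →ₗ[F] B
  ι_invol : ∀ x, ι (ι x) = x
  ι_antimul : ∀ x y : B, ι (x * y) = ι y * ι x
  finrank56 : Module.finrank F B = 56
  /-- After base change to the separable closure `K = Fsep F`, the algebra with involution is
  isomorphic to the split Brown algebra `B(Jᵈ, K×K)` (for `Jᵈ` the split Albert algebra over
  `K`), via a `K`-linear bijection onto the 56-dimensional subspace `Bsub` of the ambient model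
  which intertwines the multiplications and involutions. -/
  split : ∃ A : ReducedAlbert.{u, u} (Fsep F), A.IsSplitAlbert ∧
    ∃ f : (Fsep F) ⊗[F] B →ₗ[Fsep F] A.Bam,
      Function.Injective f ∧ LinearMap.range f = A.Bsub ∧
      (∀ x y : B, f ((1 : Fsep F) ⊗ₜ[F] (x * y))
          = A.bmul 1 (f ((1 : Fsep F) ⊗ₜ[F] x)) (f ((1 : Fsep F) ⊗ₜ[F] y))) ∧
      (∀ x : B, f ((1 : Fsep F) ⊗ₜ[F] (ι x)) = A.binv (f ((1 : Fsep F) ⊗ₜ[F] x)))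

attribute [instance] BrownAlgebra.ringB BrownAlgebra.modB BrownAlgebra.sccB BrownAlgebra.istB

namespace BrownAlgebra

variable {F : Type u} [Field F] (Br : BrownAlgebra F)

/-- The triple product `{x,y,z} := (x·ȳ)·z + (z·ȳ)·x − (z·x̄)·y`. -/
def braceA (x y z : Br.B) : Br.B :=
  (x * Br.ι y) * z + (z * Br.ι y) * x - (z * Br.ι x) * y

/-- `s₀` spans the (1-dimensional) space of skew-symmetric elements. -/
def IsSkewGen (s0 : Br.B) : Prop := s0 ≠ 0 ∧ Br.ι s0 = -s0

/-- `bB` is the skew-symmetric bilinear form of the triple system associated to `Br` and the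
skew element `s₀`: `b(x,y)` is the unique scalar with `b(x,y)•1 = (x·ȳ − y·x̄)·s₀`. -/
def IsBForm (s0 : Br.B) (bB : Br.B → Br.B → F) : Prop :=
  ∀ x y : Br.B, bB x y • (1 : Br.B) = (x * Br.ι y - y * Br.ι x) * s0

/-- The trilinear product of the triple system associated to `Br`, `s₀` and `bB`:
`t(y,z,w) := 2{y, s₀·z, w} − b(z,w)·y − b(z,y)·w − b(y,w)·z`. -/
def tripleT (s0 : Br.B) (bB : Br.B → Br.B → F) (y z w : Br.B) : Br.B :=
  (2 : F) • Br.braceA y (s0 * z) w - bB z w • y - bB z y • w - bB y w • z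

/-- An element `e` is singular: `e ≠ 0` and `U_e(B) ⊆ F·e` where `U_e x := {e,x,e}`. -/
def IsSingularA (e : Br.B) : Prop :=
  e ≠ 0 ∧ ∀ x : Br.B, ∃ c : F, Br.braceA e x e = c • e

/-- `I` is an inner ideal: `U_e(B) ⊆ I` for all `e ∈ I`. -/
def IsInnerIdealA (I : Submodule F Br.B) : Prop :=
  ∀ e ∈ I, ∀ x : Br.B, Br.braceA e x e ∈ I

end BrownAlgebra

namespace OctonionAlgebra

variable {F : Type u} [Field F] (O : OctonionAlgebra.{u, v} F)

/-- The polar form of the norm. -/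
def bl : O.C →ₗ[F] O.C →ₗ[F] F := QuadraticMap.polarBilin O.n

lemma bl_def (x y : O.C) : O.bl x y = O.n (x + y) - O.n x - O.n y := rfl

lemma conj_eq (x : O.C) : O.conj x = O.bl x 1 • (1 : O.C) - x := rfl

lemma n_add (x y : O.C) : O.n (x + y) = O.n x + O.n y + O.bl x y := by
  rw [bl_def]; ring

lemma n_smul (c : F) (x : O.C) : O.n (c • x) = c * c * O.n x := by
  rw [QuadraticMap.map_smul, smul_eq_mul]

lemma bl_comm (x y : O.C) : O.bl x y = O.bl y x := by
  rw [bl_def, bl_def, add_comm x y]; ring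

lemma bl_self (x : O.C) : O.bl x x = 2 * O.n x := by
  have h : x + x = (2 : F) • x := (two_smul F x).symm
  rw [bl_def, h, n_smul]; ring

lemma bl_ext {x y : O.C} (h : ∀ z, O.bl x z = O.bl y z) : x = y := by
  rw [← sub_eq_zero]
  refine O.nondeg _ fun z => ?_
  have : O.bl (x - y) z = 0 := by rw [map_sub, LinearMap.sub_apply, h z, sub_self]
  exact this

lemma bl_mul_left (x y z : O.C) : O.bl (x * y) (x * z) = O.n x * O.bl y z := by
  rw [bl_def, bl_def, ← mul_add, O.n_mul, O.n_mul, O.n_mul]; ring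

lemma bl_mul_right (x y z : O.C) : O.bl (y * x) (z * x) = O.bl y z * O.n x := by
  rw [bl_def, bl_def, ← add_mul, O.n_mul, O.n_mul, O.n_mul]; ring

lemma bl_mul_add (x y z w : O.C) :
    O.bl (x * y) (z * w) + O.bl (x * w) (z * y) = O.bl x z * O.bl y w := by
  have h := O.bl_mul_left (x + z) y w
  rw [O.n_add, add_mul, add_mul] at h
  simp only [map_add, LinearMap.add_apply] at h
  rw [O.bl_mul_left, O.bl_mul_left, O.bl_comm (z * y)] at h
  linear_combination h

lemma bl_mul_adj_left (x y z : O.C) : O.bl (x * y) z = O.bl y (O.conj x * z) := by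
  have h := O.bl_mul_add x y 1 z
  rw [one_mul, one_mul, O.bl_comm (x * z)] at h
  rw [conj_eq, sub_mul, smul_mul_assoc, one_mul, map_sub, map_smul, smul_eq_mul]
  linear_combination h

lemma bl_mul_adj_right (x y z : O.C) : O.bl (x * y) z = O.bl x (z * O.conj y) := by
  have h := O.bl_mul_add x y z 1
  rw [mul_one, mul_one] at h
  rw [conj_eq, mul_sub, mul_smul_comm, mul_one, map_sub, map_smul, smul_eq_mul]
  linear_combination h

lemma bl_one_one : O.bl 1 1 = 2 := by rw [bl_self, O.n_one, mul_one]

lemma conj_one : O.conj 1 = 1 := by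
  rw [conj_eq, bl_one_one, two_smul]; abel

lemma conj_conj (x : O.C) : O.conj (O.conj x) = x := by
  rw [O.conj_eq (O.conj x)]
  simp only [conj_eq, map_sub, map_smul, LinearMap.sub_apply, LinearMap.smul_apply, bl_one_one,
    smul_eq_mul]
  module

lemma bl_conj_left (x y : O.C) : O.bl (O.conj x) y = O.bl x (O.conj y) := by
  simp only [conj_eq, map_sub, map_smul, LinearMap.sub_apply, LinearMap.smul_apply, smul_eq_mul]
  rw [O.bl_comm 1 y]; ring

lemma bl_conj_conj (x y : O.C) : O.bl (O.conj x) (O.conj y) = O.bl x y := by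
  rw [bl_conj_left, conj_conj]

lemma n_conj (x : O.C) : O.n (O.conj x) = O.n x := by
  rw [conj_eq, sub_eq_add_neg, n_add, n_smul, O.n_one, QuadraticMap.map_neg, map_neg, map_smul,
    LinearMap.smul_apply, smul_eq_mul, O.bl_comm 1 x]
  ring

lemma conj_mul_cancel (x y : O.C) : O.conj x * (x * y) = O.n x • y := by
  refine O.bl_ext fun z => ?_
  rw [bl_mul_adj_left, conj_conj, bl_mul_left, map_smul, LinearMap.smul_apply, smul_eq_mul]

lemma mul_conj_cancel (x y : O.C) : (y * x) * O.conj x = O.n x • y := by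
  refine O.bl_ext fun z => ?_
  rw [bl_mul_adj_right, conj_conj, bl_mul_right, map_smul, LinearMap.smul_apply, smul_eq_mul,
    mul_comm]

lemma mul_conj_cancel_left (x y : O.C) : x * (O.conj x * y) = O.n x • y := by
  have h := O.conj_mul_cancel (O.conj x) y
  rwa [conj_conj, n_conj] at h

lemma conj_mul_cancel_right (x y : O.C) : (y * O.conj x) * x = O.n x • y := by
  have h := O.mul_conj_cancel (O.conj x) y
  rwa [conj_conj, n_conj] at h

lemma conj_mul_self (x : O.C) : O.conj x * x = O.n x • (1 : O.C) := by
  have h := O.conj_mul_cancel x 1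
  rwa [mul_one] at h

lemma mul_conj_self (x : O.C) : x * O.conj x = O.n x • (1 : O.C) := by
  have h := O.mul_conj_cancel x 1
  rwa [one_mul] at h

lemma conj_mul (x y : O.C) : O.conj (x * y) = O.conj y * O.conj x := by
  refine O.bl_ext fun z => ?_
  rw [bl_conj_left, bl_mul_adj_right, O.bl_mul_adj_right (O.conj y), conj_conj,
    O.bl_comm (O.conj y), O.bl_mul_adj_left z]

lemma moufang (a b c : O.C) :
    (a * b) * (c * a) = O.bl a (O.conj (b * c)) • a - O.n a • O.conj (b * c) := by
  refine O.bl_ext fun z => ?_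
  have h := O.bl_mul_add a b z (O.conj (c * a))
  rw [← bl_mul_adj_right, O.conj_mul c a, mul_conj_cancel_left, map_smul, LinearMap.smul_apply,
    smul_eq_mul] at h
  have h1 : O.bl b (O.conj a * O.conj c) = O.bl a (O.conj (b * c)) := by
    rw [← bl_mul_adj_left, bl_mul_adj_right, conj_mul]
  have h2 : O.bl (O.conj c) (z * b) = O.bl (O.conj (b * c)) z := by
    rw [O.bl_comm, bl_mul_adj_right, conj_mul, O.bl_comm]
  rw [h1, h2] at h
  simp only [map_sub, map_smul, LinearMap.sub_apply, LinearMap.smul_apply, smul_eq_mul]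
  linear_combination h

end OctonionAlgebra

section Polarization

variable {F : Type u} [Field F] {J : Type v} [AddCommGroup J] [Module F J]

/-- The linear coefficient of a vanishing quartic polynomial function is zero. -/
lemma linear_coeff_eq_zero (h2 : (2 : F) ≠ 0) (h3 : (3 : F) ≠ 0) {c0 c1 c2 c3 c4 : J}
    (h : ∀ l : F, c0 + l • c1 + (l * l) • c2 + (l * l * l) • c3 + (l * l * l * l) • c4 = 0) :
    c1 = 0 := by
  have h12 : (2 * 2 * 3 : F) ≠ 0 := mul_ne_zero (mul_ne_zero h2 h2) h3
  have h1 := h 1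
  have h1' := h (-1)
  have h2' := h 2
  have h2'' := h (-2)
  refine (smul_eq_zero_iff_right h12).1 ?_
  linear_combination (norm := module) (8 : F) • h1 - (8 : F) • h1' - h2' + h2''

end Polarization

/-- A cubic Jordan structure over a field in which `2` and `3` are invertible, given by its trace
form `T` and its cross product `X`. -/
structure CubicStructure (F : Type u) [Field F] (J : Type v) [AddCommGroup J] [Module F J] where
  T : J →ₗ[F] J →ₗ[F] F
  X : J →ₗ[F] J →ₗ[F] J
  T_comm : ∀ x y, T x y = T y x
  X_comm : ∀ x y, X x y = X y x
  T_X : ∀ x y z, T (X x y) z = T x (X y z)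
  T_nondeg : ∀ x, (∀ y, T x y = 0) → x = 0
  adjoint : ∀ x, (3 : F) • X (X x x) (X x x) = (4 * T (X x x) x) • x

namespace CubicStructure

variable {F : Type u} [Field F] {J : Type v} [AddCommGroup J] [Module F J]
  (S : CubicStructure F J)

lemma T_X_comm (x y z : J) : S.T (S.X x y) z = S.T (S.X x z) y := by
  rw [S.X_comm x y, S.T_X, S.T_comm]

lemma T_ext {x y : J} (h : ∀ z, S.T x z = S.T y z) : x = y := by
  rw [← sub_eq_zero]
  refine S.T_nondeg _ fun z => ?_
  rw [map_sub, LinearMap.sub_apply, h z, sub_self]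

lemma adjoint_lin (h2 : (2 : F) ≠ 0) (h3 : (3 : F) ≠ 0) (x y : J) :
    (3 : F) • S.X (S.X x x) (S.X x y)
      = (3 * S.T (S.X x x) y) • x + S.T (S.X x x) x • y := by
  have hT1 : S.T (S.X x y) x = S.T (S.X x x) y := S.T_X_comm _ _ _
  have hT2 : S.T (S.X x y) y = S.T (S.X y y) x := by rw [S.X_comm, S.T_X_comm]
  have key := linear_coeff_eq_zero h2 h3
    (c0 := (3 : F) • S.X (S.X x x) (S.X x x) - (4 * S.T (S.X x x) x) • x)
    (c1 := (4 : F) • ((3 : F) • S.X (S.X x x) (S.X x y)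
      - ((3 * S.T (S.X x x) y) • x + S.T (S.X x x) x • y)))
    (c2 := (3 : F) • ((4 : F) • S.X (S.X x y) (S.X x y) + (2 : F) • S.X (S.X x x) (S.X y y))
      - (12 * S.T (S.X y y) x) • x - (12 * S.T (S.X x x) y) • y)
    (c3 := (12 : F) • S.X (S.X x y) (S.X y y) - (4 * S.T (S.X y y) y) • x
      - (12 * S.T (S.X y y) x) • y)
    (c4 := (3 : F) • S.X (S.X y y) (S.X y y) - (4 * S.T (S.X y y) y) • y) (by
      intro l
      have h := S.adjoint (x + l • y)
      have e : S.X (x + l • y) (x + l • y)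
          = S.X x x + (2 * l) • S.X x y + (l * l) • S.X y y := by
        simp only [map_add, LinearMap.add_apply, map_smul, LinearMap.smul_apply, S.X_comm y x]
        module
      rw [e] at h
      simp only [map_add, LinearMap.add_apply, map_smul, LinearMap.smul_apply, smul_eq_mul,
        S.X_comm (S.X x y) (S.X x x), S.X_comm (S.X y y) (S.X x x),
        S.X_comm (S.X y y) (S.X x y), hT1, hT2] at h
      linear_combination (norm := module) h)
  have h4 : (4 : F) ≠ 0 := by
    have : (4 : F) = 2 * 2 := by norm_num
    rw [this]; exact mul_ne_zero h2 h2
  exact sub_eq_zero.1 ((smul_eq_zero_iff_right h4).1 key)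

lemma X_X_X (h2 : (2 : F) ≠ 0) (h3 : (3 : F) ≠ 0) (x z : J) :
    (3 : F) • S.X x (S.X (S.X x x) z)
      = (3 * S.T x z) • S.X x x + S.T (S.X x x) x • z := by
  refine S.T_ext fun y => ?_
  have h := congrArg (fun w => S.T w z) (S.adjoint_lin h2 h3 x y)
  simp only [map_add, LinearMap.add_apply, map_smul, LinearMap.smul_apply, smul_eq_mul] at h ⊢
  have e : S.T (S.X x (S.X (S.X x x) z)) y = S.T (S.X (S.X x x) (S.X x y)) z := by
    rw [S.T_X_comm, S.T_comm, ← S.T_X_comm, S.T_X, S.T_X, S.T_comm, S.T_X]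
  rw [e, h, S.T_comm z y]
  ring

lemma X_X_X_lin (h2 : (2 : F) ≠ 0) (h3 : (3 : F) ≠ 0) (x y z : J) :
    S.X y (S.X (S.X x x) z) + (2 : F) • S.X x (S.X (S.X x y) z)
      = S.T y z • S.X x x + (2 * S.T x z) • S.X x y + S.T (S.X x x) y • z := by
  have hT1 : S.T (S.X x y) x = S.T (S.X x x) y := S.T_X_comm _ _ _
  have hT2 : S.T (S.X x y) y = S.T (S.X y y) x := by rw [S.X_comm, S.T_X_comm]
  have key := linear_coeff_eq_zero h2 h3
    (c0 := (3 : F) • S.X x (S.X (S.X x x) z)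
      - (3 * S.T x z) • S.X x x - S.T (S.X x x) x • z)
    (c1 := (3 : F) • (S.X y (S.X (S.X x x) z) + (2 : F) • S.X x (S.X (S.X x y) z)
      - (S.T y z • S.X x x + (2 * S.T x z) • S.X x y + S.T (S.X x x) y • z)))
    (c2 := (3 : F) • (S.X x (S.X (S.X y y) z) + (2 : F) • S.X y (S.X (S.X x y) z)
      - (S.T x z • S.X y y + (2 * S.T y z) • S.X x y + S.T (S.X y y) x • z)))
    (c3 := (3 : F) • S.X y (S.X (S.X y y) z)
      - (3 * S.T y z) • S.X y y - S.T (S.X y y) y • z)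
    (c4 := 0) (by
      intro l
      have h := S.X_X_X h2 h3 (x + l • y) z
      have e : S.X (x + l • y) (x + l • y)
          = S.X x x + (2 * l) • S.X x y + (l * l) • S.X y y := by
        simp only [map_add, LinearMap.add_apply, map_smul, LinearMap.smul_apply, S.X_comm y x]
        module
      rw [e] at h
      simp only [map_add, LinearMap.add_apply, map_smul, LinearMap.smul_apply, smul_eq_mul,
        hT1, hT2] at h
      linear_combination (norm := module) h)
  exact sub_eq_zero.1 ((smul_eq_zero_iff_right h3).1 key)

end CubicStructure

namespace CubicStructure

variable {F : Type u} [Field F] {J : Type v} [AddCommGroup J] [Module F J]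
  (S : CubicStructure F J)

/-- The skew form of the Freudenthal triple system. -/
def skew (x y : F × J × J × F) : F :=
  x.1 * y.2.2.2 - y.1 * x.2.2.2 + S.T x.2.1 y.2.2.1 - S.T y.2.1 x.2.2.1

/-- The symmetric trilinear product of the Freudenthal triple system. -/
def tri (x y z : F × J × J × F) : F × J × J × F :=
  (-2 * (x.1 * y.1 * z.2.2.2 + x.1 * y.2.2.2 * z.1 + x.2.2.2 * y.1 * z.1)
      + x.1 * (S.T y.2.1 z.2.2.1 + S.T z.2.1 y.2.2.1)
      + y.1 * (S.T x.2.1 z.2.2.1 + S.T z.2.1 x.2.2.1)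
      + z.1 * (S.T x.2.1 y.2.2.1 + S.T y.2.1 x.2.2.1)
      - 2 * S.T (S.X x.2.2.1 y.2.2.1) z.2.2.1,
    (y.1 * z.2.2.2 + z.1 * y.2.2.2 - S.T y.2.1 z.2.2.1 - S.T z.2.1 y.2.2.1) • x.2.1
      + (x.1 * z.2.2.2 + z.1 * x.2.2.2 - S.T x.2.1 z.2.2.1 - S.T z.2.1 x.2.2.1) • y.2.1
      + (x.1 * y.2.2.2 + y.1 * x.2.2.2 - S.T x.2.1 y.2.2.1 - S.T y.2.1 x.2.2.1) • z.2.1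
      - (2 * x.2.2.2) • S.X y.2.2.1 z.2.2.1 - (2 * y.2.2.2) • S.X x.2.2.1 z.2.2.1
      - (2 * z.2.2.2) • S.X x.2.2.1 y.2.2.1
      + (2 : F) • (S.X x.2.2.1 (S.X y.2.1 z.2.1) + S.X y.2.2.1 (S.X x.2.1 z.2.1)
        + S.X z.2.2.1 (S.X x.2.1 y.2.1)),
    -(y.1 * z.2.2.2 + z.1 * y.2.2.2 - S.T y.2.1 z.2.2.1 - S.T z.2.1 y.2.2.1) • x.2.2.1
      - (x.1 * z.2.2.2 + z.1 * x.2.2.2 - S.T x.2.1 z.2.2.1 - S.T z.2.1 x.2.2.1) • y.2.2.1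
      - (x.1 * y.2.2.2 + y.1 * x.2.2.2 - S.T x.2.1 y.2.2.1 - S.T y.2.1 x.2.2.1) • z.2.2.1
      + (2 * x.1) • S.X y.2.1 z.2.1 + (2 * y.1) • S.X x.2.1 z.2.1
      + (2 * z.1) • S.X x.2.1 y.2.1
      - (2 : F) • (S.X x.2.1 (S.X y.2.2.1 z.2.2.1) + S.X y.2.1 (S.X x.2.2.1 z.2.2.1)
        + S.X z.2.1 (S.X x.2.2.1 y.2.2.1)),
    2 * (x.2.2.2 * y.2.2.2 * z.1 + x.2.2.2 * y.1 * z.2.2.2 + x.1 * y.2.2.2 * z.2.2.2)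
      - x.2.2.2 * (S.T y.2.1 z.2.2.1 + S.T z.2.1 y.2.2.1)
      - y.2.2.2 * (S.T x.2.1 z.2.2.1 + S.T z.2.1 x.2.2.1)
      - z.2.2.2 * (S.T x.2.1 y.2.2.1 + S.T y.2.1 x.2.2.1)
      + 2 * S.T (S.X x.2.1 y.2.1) z.2.1)

lemma tri_swap (x y z : F × J × J × F) : S.tri x y z = S.tri y x z := by
  simp only [tri, Prod.mk.injEq, S.X_comm y.2.1 x.2.1, S.X_comm y.2.2.1 x.2.2.1]
  refine ⟨by ring, by module, by module, by ring⟩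

lemma tri_swap' (x y z : F × J × J × F) : S.tri x y z = S.tri x z y := by
  simp only [tri, Prod.mk.injEq, S.X_comm z.2.1 y.2.1, S.X_comm z.2.2.1 y.2.2.1,
    S.T_X_comm _ z.2.1 y.2.1, S.T_X_comm _ z.2.2.1 y.2.2.1]
  refine ⟨by ring, by module, by module, by ring⟩

lemma tri_add_left (x x' y z : F × J × J × F) :
    S.tri (x + x') y z = S.tri x y z + S.tri x' y z := by
  ext
  all_goals
    simp only [tri, Prod.fst_add, Prod.snd_add, map_add, LinearMap.add_apply]
    first | ring1 | module

lemma tri_smul_left (c : F) (x y z : F × J × J × F) :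
    S.tri (c • x) y z = c • S.tri x y z := by
  ext
  all_goals
    simp only [tri, Prod.smul_fst, Prod.smul_snd, map_smul, LinearMap.smul_apply, smul_eq_mul]
    first | ring1 | module

lemma tri_add_mid (x y y' z : F × J × J × F) :
    S.tri x (y + y') z = S.tri x y z + S.tri x y' z := by
  rw [S.tri_swap, tri_add_left, S.tri_swap y, S.tri_swap y']

lemma tri_add_right (x y z z' : F × J × J × F) :
    S.tri x y (z + z') = S.tri x y z + S.tri x y z' := by
  rw [S.tri_swap', tri_add_mid, S.tri_swap' _ z, S.tri_swap' _ z']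

lemma tri_smul_mid (c : F) (x y z : F × J × J × F) :
    S.tri x (c • y) z = c • S.tri x y z := by
  rw [S.tri_swap, tri_smul_left, S.tri_swap y]

lemma tri_smul_right (c : F) (x y z : F × J × J × F) :
    S.tri x y (c • z) = c • S.tri x y z := by
  rw [S.tri_swap', tri_smul_mid, S.tri_swap' _ z]

lemma tri_self (x : F × J × J × F) : S.tri x x x =
    (-6 * x.1 * x.1 * x.2.2.2 + 6 * x.1 * S.T x.2.1 x.2.2.1 - 2 * S.T (S.X x.2.2.1 x.2.2.1) x.2.2.1,
      (6 * x.1 * x.2.2.2 - 6 * S.T x.2.1 x.2.2.1) • x.2.1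
        - (6 * x.2.2.2) • S.X x.2.2.1 x.2.2.1 + (6 : F) • S.X x.2.2.1 (S.X x.2.1 x.2.1),
      (-6 * x.1 * x.2.2.2 + 6 * S.T x.2.1 x.2.2.1) • x.2.2.1
        + (6 * x.1) • S.X x.2.1 x.2.1 - (6 : F) • S.X x.2.1 (S.X x.2.2.1 x.2.2.1),
      6 * x.1 * x.2.2.2 * x.2.2.2 - 6 * x.2.2.2 * S.T x.2.1 x.2.2.1
        + 2 * S.T (S.X x.2.1 x.2.1) x.2.1) := by
  simp only [tri, Prod.mk.injEq]
  refine ⟨by ring, by module, by module, by ring⟩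

/-- The derivation of the Freudenthal triple system attached to an element of `J`. -/
def der (c : J) : (F × J × J × F) →ₗ[F] (F × J × J × F) where
  toFun x := (0, S.X c x.2.2.1, x.1 • c, S.T c x.2.1)
  map_add' x y := by
    ext <;> simp [add_smul]
  map_smul' l x := by
    ext <;> simp [mul_smul]

lemma der_apply (c : J) (x : F × J × J × F) :
    S.der c x = (0, S.X c x.2.2.1, x.1 • c, S.T c x.2.1) := rfl

lemma der_skew (c : J) (x y : F × J × J × F) :
    S.skew (S.der c x) y + S.skew x (S.der c y) = 0 := by
  simp only [skew, der_apply, map_smul, smul_eq_mul]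
  rw [S.T_comm c x.2.1, S.T_comm c y.2.1, S.T_X_comm c y.2.2.1 x.2.2.1]
  ring

lemma der_tri_self (h2 : (2 : F) ≠ 0) (h3 : (3 : F) ≠ 0) (c : J) (x : F × J × J × F) :
    S.der c (S.tri x x x) = (3 : F) • S.tri (S.der c x) x x := by
  obtain ⟨α, b, a, β⟩ := x
  have k1 := S.X_X_X_lin h2 h3 a c b
  have k2 := S.adjoint_lin h2 h3 a c
  rw [tri_self]
  simp only [tri, der_apply, map_smul, smul_eq_mul, LinearMap.smul_apply, map_add, map_sub,
    Prod.smul_mk, Prod.mk.injEq]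
  have e1 : S.T (S.X c a) a = S.T (S.X a a) c := by rw [S.X_comm, S.T_X_comm]
  have e2 : S.T c (S.X a a) = S.T (S.X a a) c := S.T_comm _ _
  have e3 : S.T (S.X (S.X c a) b) b = S.T c (S.X a (S.X b b)) := by
    rw [S.T_X, S.T_X]
  rw [S.X_comm a c] at k1 k2
  simp only [zero_mul, mul_zero, zero_smul, add_zero, zero_add, S.T_comm b c, S.T_comm a b] at *
  rw [S.X_comm (S.X a a)] at k1 k2
  refine ⟨?_, ?_, ?_, ?_⟩
  · ring
  · rw [← e1] at k1
    linear_combination (norm := module) (-6 : F) • k1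
  · rw [← e1] at k2
    rw [S.X_comm b (S.X c a)]
    linear_combination (norm := module) (2 : F) • k2
  · linear_combination -6 * β * e2 - 6 * e3 + 6 * β * e1

lemma der_tri (h2 : (2 : F) ≠ 0) (h3 : (3 : F) ≠ 0) (c : J) (x y z : F × J × J × F) :
    S.der c (S.tri x y z)
      = S.tri (S.der c x) y z + S.tri x (S.der c y) z + S.tri x y (S.der c z) := by
  have h := fun x => S.der_tri_self h2 h3 c x
  have h6 : (6 : F) ≠ 0 := by
    have : (6 : F) = 2 * 3 := by norm_num
    rw [this]; exact mul_ne_zero h2 h3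
  have k := congrArg₂ (· + ·) (congrArg₂ (· - ·) (congrArg₂ (· - ·) (congrArg₂ (· - ·)
    (congrArg₂ (· + ·) (congrArg₂ (· + ·)
    (h (x + y + z)) (h x)) (h y)) (h (x + y))) (h (x + z))) (h (y + z))) (h z)
  simp only [tri_add_left, tri_add_mid, tri_add_right, map_add] at k
  have s1 : ∀ u v w, S.tri u v w = S.tri u w v := S.tri_swap'
  have s2 : ∀ u v w, S.tri u v w = S.tri v u w := S.tri_swap
  rw [s1 (S.der c x) z y, s1 (S.der c y) z x, s1 (S.der c z) y x, s1 x z y,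
    s2 y x z, s1 y z x, s2 y x z, s2 z x y, s1 x z y, s1 z y x, s2 z x y, s1 x z y,
    s2 (S.der c y) x z, s2 (S.der c z) x y, s1 x (S.der c z) y] at k
  refine (smul_right_injective _ h6) ?_
  linear_combination (norm := module) k

/-- Isometries of the Freudenthal triple system. -/
def IsIsometry (f : (F × J × J × F) ≃ₗ[F] (F × J × J × F)) : Prop :=
  (∀ x y, S.skew (f x) (f y) = S.skew x y) ∧ ∀ x y z, S.tri (f x) (f y) (f z) = f (S.tri x y z)

lemma IsIsometry.trans {f g : (F × J × J × F) ≃ₗ[F] (F × J × J × F)} (hf : S.IsIsometry f)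
    (hg : S.IsIsometry g) : S.IsIsometry (f.trans g) :=
  ⟨fun x y => by rw [LinearEquiv.trans_apply, LinearEquiv.trans_apply, hg.1, hf.1],
    fun x y z => by simp only [LinearEquiv.trans_apply, hg.2, hf.2]⟩

lemma isIsometry_refl : S.IsIsometry (LinearEquiv.refl F _) :=
  ⟨fun _ _ => rfl, fun _ _ _ => rfl⟩

lemma der_der {c : J} (hc : S.X c c = 0) (x : F × J × J × F) : S.der c (S.der c x) = 0 := by
  have : S.T c (S.X c x.2.2.1) = 0 := by
    rw [← S.T_X, hc, map_zero, LinearMap.zero_apply]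
  simp [der_apply, this, hc]

/-- The transvection `1 + D_c` attached to a rank one element `c`. -/
def transvection {c : J} (hc : S.X c c = 0) : (F × J × J × F) ≃ₗ[F] (F × J × J × F) :=
  LinearEquiv.ofLinearMap (LinearMap.id + S.der c) (LinearMap.id - S.der c)
    (LinearMap.ext fun x => by simp [S.der_der hc])
    (LinearMap.ext fun x => by simp [S.der_der hc])

lemma transvection_apply {c : J} (hc : S.X c c = 0) (x : F × J × J × F) :
    S.transvection hc x = x + S.der c x := rfl

lemma transvection_isIsometry (h2 : (2 : F) ≠ 0) (h3 : (3 : F) ≠ 0) {c : J} (hc : S.X c c = 0) :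
    S.IsIsometry (S.transvection hc) := by
  have hd := S.der_tri h2 h3 c
  have hdd := fun x => S.der_der hc x
  constructor
  · intro x y
    have h := S.der_skew c x y
    have h' := S.der_skew c x (S.der c y)
    have hz : ∀ x, S.skew x 0 = 0 := fun x => by simp [skew]
    rw [hdd, hz, add_zero] at h'
    simp only [transvection_apply]
    have e : ∀ x x' y y', S.skew (x + x') (y + y')
        = S.skew x y + S.skew x y' + S.skew x' y + S.skew x' y' := by
      intro x x' y y'
      simp only [skew, Prod.fst_add, Prod.snd_add, map_add, LinearMap.add_apply]
      ring
    rw [e, h']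
    linear_combination h
  · intro x y z
    have hz1 : ∀ x y, S.tri 0 x y = 0 := fun x y => by
      have := S.tri_smul_left 0 0 x y
      rwa [zero_smul, zero_smul] at this
    have hz2 : ∀ x y, S.tri x 0 y = 0 := fun x y => by rw [S.tri_swap, hz1]
    have hz3 : ∀ x y, S.tri x y 0 = 0 := fun x y => by rw [S.tri_swap', hz2]
    have k2 := hdd (S.tri x y z)
    rw [hd, map_add, map_add, hd, hd, hd] at k2
    simp only [hdd, hz1, hz2, hz3, zero_add, add_zero] at k2
    have k4 : S.tri (S.der c x) (S.der c y) z + S.tri (S.der c x) y (S.der c z)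
        + S.tri x (S.der c y) (S.der c z) = 0 := by
      refine (smul_eq_zero_iff_right h2).1 ?_
      linear_combination (norm := module) k2
    have k3 := congrArg (S.der c) k4
    rw [map_add, map_add, hd, hd, hd, map_zero] at k3
    simp only [hdd, hz1, hz2, hz3, zero_add, add_zero] at k3
    have k3' : S.tri (S.der c x) (S.der c y) (S.der c z) = 0 := by
      refine (smul_eq_zero_iff_right h3).1 ?_
      linear_combination (norm := module) k3
    simp only [transvection_apply, tri_add_left, tri_add_mid, tri_add_right, hd, k3']
    linear_combination (norm := module) k4

/-- The isometry exchanging the two halves of the triple system. -/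
def flip : (F × J × J × F) ≃ₗ[F] (F × J × J × F) :=
  LinearEquiv.ofLinearMap
    { toFun := fun x => (-x.2.2.2, -x.2.2.1, x.2.1, x.1)
      map_add' := fun x y => by ext <;> simp [add_comm]
      map_smul' := fun c x => by ext <;> simp }
    { toFun := fun x => (x.2.2.2, x.2.2.1, -x.2.1, -x.1)
      map_add' := fun x y => by ext <;> simp [add_comm]
      map_smul' := fun c x => by ext <;> simp }
    (LinearMap.ext fun x => by simp [LinearMap.comp_apply])
    (LinearMap.ext fun x => by simp [LinearMap.comp_apply])

lemma flip_apply (x : F × J × J × F) :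
    flip (F := F) (J := J) x = (-x.2.2.2, -x.2.2.1, x.2.1, x.1) := rfl

lemma flip_isIsometry : S.IsIsometry flip := by
  constructor
  · intro x y
    simp only [skew, flip_apply, map_neg, LinearMap.neg_apply]
    rw [S.T_comm x.2.2.1 y.2.1, S.T_comm y.2.2.1 x.2.1]
    ring
  · intro x y z
    simp only [tri, flip_apply, map_neg, LinearMap.neg_apply, Prod.mk.injEq, neg_neg,
      S.T_comm _ x.2.1, S.T_comm _ y.2.1, S.T_comm _ z.2.1]
    refine ⟨?_, ?_, ?_, ?_⟩
    · rw [S.T_comm z.2.1]; ring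
    · module
    · module
    · ring

end CubicStructure

namespace CubicStructure

variable {F : Type u} [Field F] {J : Type v} [AddCommGroup J] [Module F J]
  (S : CubicStructure F J)

variable {S} in
lemma IsIsometry.symm {f : (F × J × J × F) ≃ₗ[F] (F × J × J × F)} (hf : S.IsIsometry f) :
    S.IsIsometry f.symm := by
  constructor
  · intro x y
    rw [← hf.1, f.apply_symm_apply, f.apply_symm_apply]
  · intro x y z
    rw [f.eq_symm_apply, ← hf.2, f.apply_symm_apply, f.apply_symm_apply, f.apply_symm_apply]

/-- There are also transvections in the opposite direction to `S.transvection`. -/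
lemma exists_opposite_transvection (h2 : (2 : F) ≠ 0) (h3 : (3 : F) ≠ 0) {c : J}
    (hc : S.X c c = 0) : ∃ f, S.IsIsometry f ∧ ∀ x : F × J × J × F,
      f x = (x.1 + S.T c x.2.2.1, x.2.1 + x.2.2.2 • c, x.2.2.1 + S.X c x.2.1, x.2.2.2) := by
  have hc' : S.X (-c) (-c) = 0 := by simp [hc]
  refine ⟨(flip.trans (S.transvection hc')).trans flip.symm,
    ((S.flip_isIsometry.trans _ (S.transvection_isIsometry h2 h3 hc')).trans _
      S.flip_isIsometry.symm), fun x => ?_⟩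
  rw [LinearEquiv.trans_apply, LinearEquiv.symm_apply_eq]
  simp only [LinearEquiv.trans_apply, flip_apply, transvection_apply, der_apply]
  ext <;> simp [add_comm]

lemma exists_isometry_swap (h2 : (2 : F) ≠ 0) (h3 : (3 : F) ≠ 0) {h d : J}
    (hh : S.X h h = 0) (hd : S.X d d = 0) (hT : S.T h d ≠ 0) :
    ∃ f, S.IsIsometry f ∧ f (1, 0, 0, 0) = (0, -h, 0, 0) ∧
      f (0, d, 0, 0) = (-S.T h d, 0, 0, 0) := by
  obtain ⟨g, hg, hg'⟩ := S.exists_opposite_transvection h2 h3 (c := -(S.T h d)⁻¹ • d)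
    (by simp [hd])
  refine ⟨((S.transvection hh).trans g).trans flip,
    ((S.transvection_isIsometry h2 h3 hh).trans _ hg).trans _ S.flip_isIsometry, ?_, ?_⟩
  · simp only [LinearEquiv.trans_apply, flip_apply, transvection_apply, der_apply, hg']
    simp [S.T_comm d h, hT]
  · simp only [LinearEquiv.trans_apply, flip_apply, transvection_apply, der_apply, hg']
    simp [hd, hT]

lemma exists_isometry_move (h2 : (2 : F) ≠ 0) (h3 : (3 : F) ≠ 0) {p q r : J}
    (hp : S.X p p = 0) (hq : S.X q q = 0) (hr : S.X r r = 0) (hqp : S.T q p ≠ 0)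
    (hrq : S.T r q ≠ 0) :
    ∃ f, S.IsIsometry f ∧ (∃ s : F, s ≠ 0 ∧ f (1, 0, 0, 0) = (s, 0, 0, 0)) ∧
      ∃ s : F, s ≠ 0 ∧ f (0, p, 0, 0) = (0, s • r, 0, 0) := by
  obtain ⟨f, hf, hf1, hf2⟩ := S.exists_isometry_swap h2 h3 hq hp hqp
  obtain ⟨g, hg, hg1, hg2⟩ := S.exists_isometry_swap h2 h3 hr hq hrq
  refine ⟨f.trans g, hf.trans _ hg, ⟨S.T r q, hrq, ?_⟩, ⟨S.T q p, hqp, ?_⟩⟩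
  · have : ((0, -q, 0, 0) : F × J × J × F) = -(0, q, 0, 0) := by simp
    rw [LinearEquiv.trans_apply, hf1, this, map_neg, hg2]
    simp
  · have : ((-S.T q p, 0, 0, 0) : F × J × J × F) = (-S.T q p) • (1, 0, 0, 0) := by simp
    rw [LinearEquiv.trans_apply, hf2, this, map_smul, hg1]
    simp

/-- The polarized inner ideal condition. -/
def IsInner (I : Submodule F (F × J × J × F)) : Prop :=
  ∀ x ∈ I, ∀ y ∈ I, ∀ z, S.tri x y z ∈ I

variable {S} in
lemma IsInner.map {I : Submodule F (F × J × J × F)} (hI : S.IsInner I)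
    {f : (F × J × J × F) ≃ₗ[F] (F × J × J × F)} (hf : S.IsIsometry f) :
    S.IsInner (I.map (f : (F × J × J × F) →ₗ[F] (F × J × J × F))) := by
  rintro _ ⟨x, hx, rfl⟩ _ ⟨y, hy, rfl⟩ z
  refine ⟨_, hI x hx y hy (f.symm z), ?_⟩
  simp only [LinearEquiv.coe_coe]
  rw [← hf.2, f.apply_symm_apply]

variable {S} {I : Submodule F (F × J × J × F)}

lemma IsInner.eq_top (hI : S.IsInner I) (h1 : ((1, 0, 0, 0) : F × J × J × F) ∈ I)
    (h2 : ((0, 0, 0, 1) : F × J × J × F) ∈ I) : I = ⊤ := by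
  rw [eq_top_iff]
  rintro ⟨α, b, a, β⟩ -
  have hb := hI _ h1 _ h2 (0, b, 0, 0)
  have ha := hI _ h1 _ h2 (0, 0, -a, 0)
  simp only [tri] at hb ha
  convert I.add_mem (I.add_mem (I.add_mem (I.smul_mem α h1) (I.smul_mem β h2)) hb) ha using 1
  simp

lemma IsInner.fst_mem_of (h2 : (2 : F) ≠ 0) (h3 : (3 : F) ≠ 0) (hI : S.IsInner I) {α β : F}
    {b : J} (hα : α ≠ 0) (h : ((α, b, 0, β) : F × J × J × F) ∈ I) :
    ((1, 0, 0, 0) : F × J × J × F) ∈ I := by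
  have k1 := hI _ h _ h (0, 0, 0, 1)
  have k2 : ((2 * α, 0, 0, -β) : F × J × J × F) ∈ I := by
    rw [← I.smul_mem_iff (mul_ne_zero (neg_ne_zero.2 h2) hα)]
    convert I.sub_mem k1 (I.smul_mem (2 * α) h) using 1
    ext
    · simp [tri]; ring
    · simp [tri]; module
    · simp [tri]
    · simp [tri]; ring
  have k3 := hI _ k2 _ k2 (1, 0, 0, 0)
  by_cases hβ : β = 0
  · rw [← I.smul_mem_iff (mul_ne_zero h2 hα)]
    simpa [hβ] using k2
  · rw [← I.smul_mem_iff (mul_ne_zero (mul_ne_zero (mul_ne_zero h2 h2) h3) (mul_ne_zero hα hβ))]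
    convert I.add_mem k3 (I.smul_mem (2 * β) k2) using 1
    ext
    · simp [tri]; ring
    · simp [tri]
    · simp [tri]
    · simp [tri]; ring

/-- An element of a proper inner ideal containing `(1,0;0,0)` has components in that ideal. -/
lemma IsInner.components (h2 : (2 : F) ≠ 0) (h3 : (3 : F) ≠ 0) (hI : S.IsInner I) (hI' : I ≠ ⊤)
    (h1 : ((1, 0, 0, 0) : F × J × J × F) ∈ I) {x : F × J × J × F} (hx : x ∈ I) :
    x.2.2.2 = 0 ∧ ((0, x.2.1, 0, 0) : F × J × J × F) ∈ I ∧
      ((0, 0, x.2.2.1, 0) : F × J × J × F) ∈ I := by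
  obtain ⟨α, b, a, β⟩ := x
  have k1 : ((0, b, a, β) : F × J × J × F) ∈ I := by
    convert I.sub_mem hx (I.smul_mem α h1) using 1
    simp
  have k : ∀ (b a : J) (β : F), ((0, b, a, β) : F × J × J × F) ∈ I →
      ((0, b, -a, 2 * β) : F × J × J × F) ∈ I := by
    intro b a β h
    convert hI _ h1 _ h (0, 0, 0, 1) using 1
    simp [tri]
  have k2 := k _ _ _ k1
  have k3 := k _ _ _ k2
  have hβ : β = 0 := by
    by_contra hβ
    refine hI' (hI.eq_top h1 ?_)
    rw [← I.smul_mem_iff (mul_ne_zero h3 hβ)]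
    convert I.sub_mem k3 k1 using 1
    simp; ring
  subst hβ
  refine ⟨rfl, ?_, ?_⟩
  · rw [← I.smul_mem_iff h2]
    convert I.add_mem k1 k2 using 1
    simp [two_smul]
  · rw [← I.smul_mem_iff h2]
    convert I.sub_mem k1 k2 using 1
    simp [two_smul]

lemma IsInner.cross_mem_left (h2 : (2 : F) ≠ 0) (hI : S.IsInner I)
    (h1 : ((1, 0, 0, 0) : F × J × J × F) ∈ I) {b : J}
    (hb : ((0, b, 0, 0) : F × J × J × F) ∈ I) (k : J) :
    ((0, 0, S.X b k, 0) : F × J × J × F) ∈ I := by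
  rw [← I.smul_mem_iff h2]
  convert hI _ h1 _ hb (0, k, 0, 0) using 1
  simp [tri]

lemma IsInner.cross_mem_right (h2 : (2 : F) ≠ 0) (hI : S.IsInner I) {a a' : J}
    (ha : ((0, 0, a, 0) : F × J × J × F) ∈ I) (ha' : ((0, 0, a', 0) : F × J × J × F) ∈ I) :
    ((0, S.X a a', 0, 0) : F × J × J × F) ∈ I := by
  rw [← I.smul_mem_iff (neg_ne_zero.2 h2)]
  convert hI _ ha _ ha' (0, 0, 0, 1) using 1
  simp [tri]

lemma IsInner.cross_eq_zero (h2 : (2 : F) ≠ 0) (h3 : (3 : F) ≠ 0) (hI : S.IsInner I)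
    (hI' : I ≠ ⊤) (h1 : ((1, 0, 0, 0) : F × J × J × F) ∈ I) {b b' : J}
    (hb : ((0, b, 0, 0) : F × J × J × F) ∈ I) (hb' : ((0, b', 0, 0) : F × J × J × F) ∈ I) :
    S.X b b' = 0 := by
  refine S.T_nondeg _ fun y => ?_
  have := (hI.components h2 h3 hI' h1 (hI _ hb _ hb' (0, y, 0, 0))).1
  simpa [tri, h2] using this

/-- Some isometry moves a nonzero inner ideal to one containing `(1,0;0,0)`. -/
lemma IsInner.exists_isometry_mem (h2 : (2 : F) ≠ 0) (h3 : (3 : F) ≠ 0)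
    (hspan : Submodule.span F {c : J | S.X c c = 0} = ⊤) (hI : S.IsInner I) (hI' : I ≠ ⊥) :
    ∃ f, S.IsIsometry f ∧
      ((1, 0, 0, 0) : F × J × J × F) ∈ I.map (f : (F × J × J × F) →ₗ[F] (F × J × J × F)) := by
  obtain ⟨x, hx, hx0⟩ := I.ne_bot_iff.1 hI'
  have hT : ∀ a : J, a ≠ 0 → ∃ c, S.X c c = 0 ∧ S.T c a ≠ 0 := by
    intro a ha
    by_contra! hc
    refine ha (S.T_nondeg _ fun y => ?_)
    have hy : y ∈ Submodule.span F {c : J | S.X c c = 0} := hspan ▸ Submodule.mem_top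
    rw [S.T_comm]
    induction hy using Submodule.span_induction with
    | mem c hc' => exact hc c hc'
    | zero => simp
    | add u w _ _ hu hw => simp [hu, hw]
    | smul r u _ hu => simp [hu]
  have step1 : ∀ x : F × J × J × F, x.2.2.1 ≠ 0 → ∃ f, S.IsIsometry f ∧ (f x).1 ≠ 0 := by
    intro x hx
    by_cases h0 : x.1 = 0
    · obtain ⟨c, hc, hca⟩ := hT _ hx
      obtain ⟨f, hf, hf'⟩ := S.exists_opposite_transvection h2 h3 hc
      exact ⟨f, hf, by simpa [hf', h0] using hca⟩
    · exact ⟨_, S.isIsometry_refl, h0⟩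
  have step2 : ∃ f, S.IsIsometry f ∧ (f x).1 ≠ 0 := by
    by_cases h1 : x.1 = 0
    · by_cases ha : x.2.2.1 = 0
      · by_cases hb : x.2.1 = 0
        · refine ⟨_, S.flip_isIsometry, ?_⟩
          intro h
          exact hx0 (by ext <;> simp_all [flip_apply])
        · obtain ⟨f, hf, hf'⟩ := step1 (flip x) hb
          exact ⟨_, S.flip_isIsometry.trans _ hf, hf'⟩
      · exact step1 x ha
    · exact ⟨_, S.isIsometry_refl, h1⟩
  obtain ⟨f, hf, hfx⟩ := step2
  have step3 : ∀ y : J, y ∈ Submodule.span F {c : J | S.X c c = 0} →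
      ∀ (r : F) (x : F × J × J × F), ∃ f, S.IsIsometry f ∧ (f x).1 = x.1 ∧
        (f x).2.2.1 = x.2.2.1 + x.1 • r • y := by
    intro y hy
    induction hy using Submodule.span_induction with
    | mem c hc =>
      have hc' : S.X c c = 0 := hc
      intro r x
      have hr : S.X (r • c) (r • c) = 0 := by simp [hc']
      exact ⟨_, S.transvection_isIsometry h2 h3 hr, by simp [transvection_apply, der_apply],
        by simp [transvection_apply, der_apply]⟩
    | zero => exact fun r x => ⟨_, S.isIsometry_refl, rfl, by simp⟩
    | add u w _ _ hu hw =>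
      intro r x
      obtain ⟨f, hf, hf1, hf2⟩ := hu r x
      obtain ⟨g, hg, hg1, hg2⟩ := hw r (f x)
      refine ⟨_, hf.trans _ hg, ?_, ?_⟩
      · rw [LinearEquiv.trans_apply, hg1, hf1]
      · rw [LinearEquiv.trans_apply, hg2, hf1, hf2, smul_add, smul_add, add_assoc]
    | smul c u _ hu =>
      intro r x
      obtain ⟨f, hf, hf1, hf2⟩ := hu (r * c) x
      exact ⟨f, hf, hf1, by rw [hf2, mul_smul]⟩
  obtain ⟨g, hg, hg1, hg2⟩ := step3 (f x).2.2.1 (hspan ▸ Submodule.mem_top)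
    (-(f x).1⁻¹) (f x)
  refine ⟨_, hf.trans _ hg, ?_⟩
  have hI2 := hI.map (hf.trans _ hg)
  have hm : g (f x) ∈ I.map ((f.trans g : (F × J × J × F) ≃ₗ[F] (F × J × J × F)) :
      (F × J × J × F) →ₗ[F] (F × J × J × F)) := ⟨x, hx, rfl⟩
  rw [smul_smul, mul_neg, mul_inv_cancel₀ hfx, neg_one_smul, add_neg_cancel] at hg2
  refine hI2.fst_mem_of h2 h3 (α := (g (f x)).1) (b := (g (f x)).2.1) (β := (g (f x)).2.2.2)
    (by rwa [hg1]) ?_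
  rwa [← hg2]

end CubicStructure

namespace OctonionAlgebra

variable {F : Type u} [Field F] (O : OctonionAlgebra.{u, v} F)

lemma bl_conj_mul_left (x y z : O.C) : O.bl (O.conj (x * y)) z = O.bl x (O.conj (y * z)) := by
  rw [bl_conj_left, bl_mul_adj_right, conj_mul]

/-- Coordinates `(ε₀,ε₁,ε₂,a,b,c)` of hermitian `3 × 3` matrices over `O`. -/
abbrev Herm : Type (max u v) := F × F × F × O.C × O.C × O.C

/-- The trace form in coordinates. -/
def hermT : O.Herm →ₗ[F] O.Herm →ₗ[F] F :=
  LinearMap.mk₂ F (fun x y => x.1 * y.1 + x.2.1 * y.2.1 + x.2.2.1 * y.2.2.1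
      + O.bl x.2.2.2.1 y.2.2.2.1 + O.bl x.2.2.2.2.1 y.2.2.2.2.1 + O.bl x.2.2.2.2.2 y.2.2.2.2.2)
    (fun x x' y => by simp only [Prod.fst_add, Prod.snd_add, map_add, LinearMap.add_apply]; ring)
    (fun c x y => by
      simp only [Prod.smul_fst, Prod.smul_snd, map_smul, LinearMap.smul_apply, smul_eq_mul]; ring)
    (fun x y y' => by simp only [Prod.fst_add, Prod.snd_add, map_add]; ring)
    (fun c x y => by simp only [Prod.smul_fst, Prod.smul_snd, map_smul, smul_eq_mul]; ring)

lemma hermT_apply (x y : O.Herm) : O.hermT x y =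
    x.1 * y.1 + x.2.1 * y.2.1 + x.2.2.1 * y.2.2.1
      + O.bl x.2.2.2.1 y.2.2.2.1 + O.bl x.2.2.2.2.1 y.2.2.2.2.1
      + O.bl x.2.2.2.2.2 y.2.2.2.2.2 := rfl

/-- The cross product in coordinates. -/
def hermX : O.Herm →ₗ[F] O.Herm →ₗ[F] O.Herm :=
  LinearMap.mk₂ F (fun x y =>
    (x.2.1 * y.2.2.1 + x.2.2.1 * y.2.1 - O.bl x.2.2.2.1 y.2.2.2.1,
      x.2.2.1 * y.1 + x.1 * y.2.2.1 - O.bl x.2.2.2.2.1 y.2.2.2.2.1,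
      x.1 * y.2.1 + x.2.1 * y.1 - O.bl x.2.2.2.2.2 y.2.2.2.2.2,
      O.conj (x.2.2.2.2.1 * y.2.2.2.2.2 + y.2.2.2.2.1 * x.2.2.2.2.2)
        - x.1 • y.2.2.2.1 - y.1 • x.2.2.2.1,
      O.conj (x.2.2.2.2.2 * y.2.2.2.1 + y.2.2.2.2.2 * x.2.2.2.1)
        - x.2.1 • y.2.2.2.2.1 - y.2.1 • x.2.2.2.2.1,
      O.conj (x.2.2.2.1 * y.2.2.2.2.1 + y.2.2.2.1 * x.2.2.2.2.1)
        - x.2.2.1 • y.2.2.2.2.2 - y.2.2.1 • x.2.2.2.2.2))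
    (fun x x' y => by
      simp only [Prod.fst_add, Prod.snd_add, map_add, LinearMap.add_apply, add_mul, mul_add,
        Prod.mk_add_mk, Prod.mk.injEq]
      refine ⟨by ring, by ring, by ring, by module, by module, by module⟩)
    (fun c x y => by
      simp only [Prod.smul_fst, Prod.smul_snd, map_smul, map_add, LinearMap.smul_apply,
        smul_eq_mul, smul_mul_assoc, mul_smul_comm, Prod.smul_mk, Prod.mk.injEq]
      refine ⟨by ring, by ring, by ring, by module, by module, by module⟩)
    (fun x y y' => by
      simp only [Prod.fst_add, Prod.snd_add, map_add, add_mul, mul_add,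
        Prod.mk_add_mk, Prod.mk.injEq]
      refine ⟨by ring, by ring, by ring, by module, by module, by module⟩)
    (fun c x y => by
      simp only [Prod.smul_fst, Prod.smul_snd, map_smul, map_add,
        smul_eq_mul, smul_mul_assoc, mul_smul_comm, Prod.smul_mk, Prod.mk.injEq]
      refine ⟨by ring, by ring, by ring, by module, by module, by module⟩)

lemma hermX_apply (x y : O.Herm) : O.hermX x y =
    (x.2.1 * y.2.2.1 + x.2.2.1 * y.2.1 - O.bl x.2.2.2.1 y.2.2.2.1,
      x.2.2.1 * y.1 + x.1 * y.2.2.1 - O.bl x.2.2.2.2.1 y.2.2.2.2.1,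
      x.1 * y.2.1 + x.2.1 * y.1 - O.bl x.2.2.2.2.2 y.2.2.2.2.2,
      O.conj (x.2.2.2.2.1 * y.2.2.2.2.2 + y.2.2.2.2.1 * x.2.2.2.2.2)
        - x.1 • y.2.2.2.1 - y.1 • x.2.2.2.1,
      O.conj (x.2.2.2.2.2 * y.2.2.2.1 + y.2.2.2.2.2 * x.2.2.2.1)
        - x.2.1 • y.2.2.2.2.1 - y.2.1 • x.2.2.2.2.1,
      O.conj (x.2.2.2.1 * y.2.2.2.2.1 + y.2.2.2.1 * x.2.2.2.2.1)
        - x.2.2.1 • y.2.2.2.2.2 - y.2.2.1 • x.2.2.2.2.2) := rfl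

/-- The adjoint of a hermitian matrix in coordinates. -/
def hermSharp (x : O.Herm) : O.Herm :=
  (x.2.1 * x.2.2.1 - O.n x.2.2.2.1, x.2.2.1 * x.1 - O.n x.2.2.2.2.1,
    x.1 * x.2.1 - O.n x.2.2.2.2.2,
    O.conj (x.2.2.2.2.1 * x.2.2.2.2.2) - x.1 • x.2.2.2.1,
    O.conj (x.2.2.2.2.2 * x.2.2.2.1) - x.2.1 • x.2.2.2.2.1,
    O.conj (x.2.2.2.1 * x.2.2.2.2.1) - x.2.2.1 • x.2.2.2.2.2)

lemma hermX_self (x : O.Herm) : O.hermX x x = (2 : F) • O.hermSharp x := by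
  simp only [hermX_apply, hermSharp, bl_self, Prod.smul_mk, Prod.mk.injEq, smul_eq_mul, map_add]
  refine ⟨by ring, by ring, by ring, by module, by module, by module⟩

/-- The cubic norm of a hermitian matrix in coordinates. -/
def hermN (x : O.Herm) : F :=
  x.1 * x.2.1 * x.2.2.1 - x.1 * O.n x.2.2.2.1 - x.2.1 * O.n x.2.2.2.2.1
    - x.2.2.1 * O.n x.2.2.2.2.2 + O.bl x.2.2.2.1 (O.conj (x.2.2.2.2.1 * x.2.2.2.2.2))

lemma bl_conj_mul_cycle (a b c : O.C) :
    O.bl b (O.conj (c * a)) = O.bl a (O.conj (b * c)) := by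
  rw [O.bl_comm a, bl_conj_mul_left]

lemma hermT_sharp (x : O.Herm) : O.hermT (O.hermSharp x) x = 3 * O.hermN x := by
  obtain ⟨p, q, r, a, b, c⟩ := x
  simp only [hermT_apply, hermSharp, hermN, map_sub, map_smul, LinearMap.sub_apply,
    LinearMap.smul_apply, smul_eq_mul, bl_self]
  rw [O.bl_comm _ a, O.bl_comm _ b, O.bl_comm _ c, O.bl_conj_mul_cycle b c a,
    O.bl_conj_mul_cycle a b c]
  ring

lemma hermSharp_diag (p q r : F) (a b c : O.C) :
    (r * p - O.n b) * (p * q - O.n c) - O.n (O.conj (b * c) - p • a)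
      = p * (p * q * r - p * O.n a - q * O.n b - r * O.n c + O.bl a (O.conj (b * c))) := by
  rw [sub_eq_add_neg (O.conj _), O.n_add, n_conj, O.n_mul, QuadraticMap.map_neg, n_smul, map_neg,
    map_smul, smul_eq_mul, O.bl_comm _ a]
  ring

lemma hermSharp_offdiag (p q r : F) (a b c : O.C) :
    O.conj ((O.conj (c * a) - q • b) * (O.conj (a * b) - r • c))
        - (q * r - O.n a) • (O.conj (b * c) - p • a)
      = (p * q * r - p * O.n a - q * O.n b - r * O.n c + O.bl a (O.conj (b * c))) • a := by
  have e1 := O.moufang a b c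
  have e2 := O.mul_conj_cancel b a
  have e3 := O.conj_mul_cancel c a
  rw [conj_mul, map_sub, map_sub, conj_conj, conj_conj, sub_mul, mul_sub, mul_sub, e1, map_smul,
    map_smul, mul_smul_comm, smul_mul_assoc, smul_mul_assoc, mul_smul_comm, e2, e3, ← conj_mul]
  module

lemma hermSharp_hermSharp (x : O.Herm) :
    O.hermSharp (O.hermSharp x) = O.hermN x • x := by
  obtain ⟨p, q, r, a, b, c⟩ := x
  have c1 := O.bl_conj_mul_cycle a b c
  have c2 := O.bl_conj_mul_cycle b c a
  simp only [hermSharp, hermN, Prod.smul_mk, Prod.mk.injEq, smul_eq_mul]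
  refine ⟨?_, ?_, ?_, ?_, ?_, ?_⟩
  · rw [hermSharp_diag]; ring
  · rw [O.hermSharp_diag q r p b c a, c1]; ring
  · rw [O.hermSharp_diag r p q c a b, c2, c1]; ring
  · rw [hermSharp_offdiag]
  · rw [O.hermSharp_offdiag q r p b c a, c1]; module
  · rw [O.hermSharp_offdiag r p q c a b, c2, c1]; module

/-- The cubic structure on hermitian `3 × 3` matrices over `O`. -/
def herm : CubicStructure F O.Herm where
  T := O.hermT
  X := O.hermX
  T_comm x y := by
    simp only [hermT_apply]
    rw [O.bl_comm x.2.2.2.1, O.bl_comm x.2.2.2.2.1, O.bl_comm x.2.2.2.2.2]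
    ring
  X_comm x y := by
    simp only [hermX_apply, Prod.mk.injEq]
    rw [O.bl_comm x.2.2.2.1, O.bl_comm x.2.2.2.2.1, O.bl_comm x.2.2.2.2.2]
    refine ⟨by ring, by ring, by ring, ?_, ?_, ?_⟩ <;> rw [add_comm] <;> module
  T_X x y z := by
    simp only [hermX_apply, hermT_apply, map_add, map_sub, map_smul, LinearMap.add_apply,
      LinearMap.sub_apply, LinearMap.smul_apply, smul_eq_mul, bl_conj_mul_left]
    obtain ⟨p, q, r, a, b, c⟩ := x
    obtain ⟨p', q', r', a', b', c'⟩ := y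
    obtain ⟨p'', q'', r'', a'', b'', c''⟩ := z
    simp only
    have e : ∀ x y z, O.bl x (O.conj (y * z)) = O.bl y (O.conj (z * x)) :=
      fun x y z => by rw [O.bl_comm x, bl_conj_mul_left]
    rw [e b' c a'', e c' a b'', e a' b c'']
    ring
  T_nondeg x h := by
    obtain ⟨p, q, r, a, b, c⟩ := x
    have h1 := h (1, 0, 0, 0, 0, 0)
    have h2 := h (0, 1, 0, 0, 0, 0)
    have h3 := h (0, 0, 1, 0, 0, 0)
    have ha : a = 0 := O.nondeg a fun y => by
      have := h (0, 0, 0, y, 0, 0)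
      simp only [hermT_apply, mul_zero, map_zero, add_zero, zero_add] at this
      exact this
    have hb : b = 0 := O.nondeg b fun y => by
      have := h (0, 0, 0, 0, y, 0)
      simp only [hermT_apply, mul_zero, map_zero, add_zero, zero_add] at this
      exact this
    have hc : c = 0 := O.nondeg c fun y => by
      have := h (0, 0, 0, 0, 0, y)
      simp only [hermT_apply, mul_zero, map_zero, add_zero, zero_add] at this
      exact this
    simp [hermT_apply] at h1 h2 h3
    simp [h1, h2, h3, ha, hb, hc]
  adjoint x := by
    simp only [O.hermX_self x, map_smul, LinearMap.smul_apply, smul_eq_mul]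
    rw [hermX_self, hermSharp_hermSharp, hermT_sharp]
    module

end OctonionAlgebra

namespace OctonionAlgebra

variable {F : Type u} [Field F] (O : OctonionAlgebra.{u, v} F)

instance : FiniteDimensional F O.C :=
  .of_finrank_pos (by rw [O.finrank_eq]; norm_num)

lemma bl_nondegenerate : LinearMap.BilinForm.Nondegenerate (O.bl : LinearMap.BilinForm F O.C) := by
  refine ⟨fun x hx => O.bl_ext fun y => ?_, fun x hx => O.bl_ext fun y => ?_⟩
  · rw [hx, map_zero, LinearMap.zero_apply]
  · rw [O.bl_comm, hx, map_zero, LinearMap.zero_apply]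

lemma bl_eq_zero_of_isotropic {W : Submodule F O.C} (hW : ∀ x ∈ W, O.n x = 0) {x y : O.C}
    (hx : x ∈ W) (hy : y ∈ W) : O.bl x y = 0 := by
  have := O.n_add x y
  rw [hW _ hx, hW _ hy, hW _ (W.add_mem hx hy)] at this
  simpa using this.symm

lemma finrank_le_of_isotropic {W : Submodule F O.C} (hW : ∀ x ∈ W, O.n x = 0) :
    Module.finrank F W ≤ 4 := by
  have h := LinearMap.BilinForm.finrank_orthogonal O.bl_nondegenerate W
  have hle : W ≤ LinearMap.BilinForm.orthogonal O.bl W := fun x hx y hy =>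
    O.bl_eq_zero_of_isotropic hW hy hx
  have := Submodule.finrank_mono hle
  have := Submodule.finrank_le W
  rw [O.finrank_eq] at *
  omega

lemma exists_bl_eq_one {u u' : O.C} (hu : u ∉ Submodule.span F {u'}) :
    ∃ w, O.bl w u = 1 ∧ O.bl w u' = 0 := by
  obtain ⟨φ, hφ, hφ'⟩ := Submodule.exists_le_ker_of_notMem hu
  obtain ⟨w, rfl⟩ := (LinearMap.BilinForm.toDual _ O.bl_nondegenerate).surjective φ
  have hw : O.bl w u ≠ 0 := hφ
  have hw' : O.bl w u' = 0 := hφ' (Submodule.mem_span_singleton_self u')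
  exact ⟨(O.bl w u)⁻¹ • w, by simp [hw], by simp [hw']⟩

lemma conj_mul_cancel_lin (x y z : O.C) :
    O.conj x * (z * y) + O.conj z * (x * y) = O.bl x z • y := by
  have h := O.conj_mul_cancel (x + z) y
  rw [map_add, O.n_add, add_mul, add_mul, mul_add, mul_add, add_smul, add_smul,
    O.conj_mul_cancel, O.conj_mul_cancel] at h
  rw [← sub_eq_zero] at h ⊢
  rw [← h]
  abel

lemma mul_conj_cancel_lin (x y z : O.C) :
    (y * x) * O.conj z + (y * z) * O.conj x = O.bl x z • y := by
  have h := O.mul_conj_cancel (x + z) y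
  rw [map_add, O.n_add, mul_add, mul_add, add_mul, add_mul, add_smul, add_smul,
    O.mul_conj_cancel, O.mul_conj_cancel] at h
  rw [← sub_eq_zero] at h ⊢
  rw [← h]
  abel

/-- An isotropic subspace stable under `x ↦ (x * p) * q` vanishes. -/
lemma eq_bot_of_isotropic_of_mul_mem {X : Submodule F O.C} (hX : ∀ x ∈ X, O.n x = 0)
    (hmul : ∀ x ∈ X, ∀ p q, (x * p) * q ∈ X) : X = ⊥ := by
  by_contra hne
  obtain ⟨x, hx, hx0⟩ := X.ne_bot_iff.1 hne
  have hmul' : ∀ x ∈ X, ∀ p, x * p ∈ X := fun x hx p => by simpa using hmul x hx p 1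
  obtain ⟨e, he, he1⟩ : ∃ e ∈ X, O.bl e 1 = 1 := by
    obtain ⟨w, hw, -⟩ := O.exists_bl_eq_one (u := x) (u' := 0) (by simpa using hx0)
    refine ⟨x * O.conj w, hmul' _ hx _, ?_⟩
    rw [bl_mul_adj_right, conj_conj, one_mul, bl_comm, hw]
  have hne0 := hX e he
  have hf : O.conj e = 1 - e := by rw [conj_eq, he1, one_smul]
  have hee : e * e = e := by
    have := O.conj_mul_self e
    rw [hf, hne0, zero_smul, sub_mul, one_mul, sub_eq_zero] at this
    exact this.symm
  have heez : ∀ z, e * (e * z) = e * z := fun z => by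
    have := O.conj_mul_cancel e z
    rw [hf, hne0, zero_smul, sub_mul, one_mul, sub_eq_zero] at this
    exact this.symm
  have hzee : ∀ z, (z * e) * e = z * e := fun z => by
    have := O.mul_conj_cancel e z
    rw [hf, hne0, zero_smul, mul_sub, mul_one, sub_eq_zero] at this
    exact this.symm
  have hkill : ∀ r s, O.conj e * ((e * r) * s) = 0 := fun r s => by
    refine O.bl_ext fun p => ?_
    rw [bl_comm, ← bl_mul_adj_left, O.bl_eq_zero_of_isotropic hX (hmul' _ he _) (hmul _ he _ _),
      map_zero, LinearMap.zero_apply]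
  have hconj : ∀ u, O.bl u 1 = 0 → O.conj u = -u := fun u hu => by
    rw [conj_eq, hu, zero_smul, zero_sub]
  have hUe : ∀ u, e * u = u → O.bl u 1 = 0 → u * e = 0 := fun u h1 h2 => by
    have := congrArg O.conj h1
    rw [conj_mul, hconj u h2, hf, mul_sub, mul_one, neg_mul] at this
    simpa using this
  have hline : ∀ u u', e * u = u → O.bl u 1 = 0 → e * u' = u' → O.bl u' 1 = 0 → u' ≠ 0 →
      u ∈ Submodule.span F {u'} := by
    intro u u' hu hu1 hu' hu1' hu0
    by_contra hnot
    obtain ⟨w, hw, hw'⟩ := O.exists_bl_eq_one hnot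
    have huu' : u * u' = 0 := by
      have h := O.conj_mul_cancel_lin e u' u
      have h' := hkill u u'
      rw [hu] at h'
      have hb : O.bl e u = 0 := by
        have := O.bl_mul_left e 1 u
        rwa [mul_one, hu, hne0, zero_mul] at this
      rw [h', hu', hconj u hu1, hb, zero_smul, zero_add, neg_mul, neg_eq_zero] at h
      exact h
    set v := (O.conj e * w) * e with hv
    have hev : e * v = 0 := by
      have h := O.conj_mul_cancel_lin e e (O.conj e * w)
      have hb1 : O.bl (O.conj e * w) 1 = O.bl w e := by
        rw [bl_mul_adj_left, conj_conj, mul_one]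
      have hb2 : O.bl e (O.conj e * w) = O.bl w e := by
        rw [bl_comm, bl_mul_adj_left, conj_conj, hee]
      rw [hee, O.conj_eq (O.conj e * w), hb1, hb2, sub_mul, smul_mul_assoc, one_mul, ← hv] at h
      rw [hf, sub_mul, one_mul] at h
      simpa using h
    have hbl : ∀ y, e * y = y → y * e = 0 → O.bl v y = O.bl w y := fun y h1 h2 => by
      rw [hv, bl_mul_adj_right, hf, mul_sub, mul_one, h2, sub_zero, ← hf, bl_mul_adj_left,
        conj_conj, h1]
    have hv1 : O.bl v 1 = 0 := by
      rw [hv, bl_mul_adj_right, one_mul, bl_mul_adj_left, conj_conj, hf, mul_sub, mul_one, hee,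
        sub_self, map_zero]
    have hve : O.bl e v = 0 := by
      have := O.bl_mul_right e 1 (O.conj e * w)
      rwa [one_mul, hne0, mul_zero] at this
    have hz1 : e * (v * u') = 0 := by
      have h := O.conj_mul_cancel_lin e u' v
      rw [hu', hve, zero_smul, hconj v hv1, hf, sub_mul, one_mul, neg_mul] at h
      rwa [← sub_eq_add_neg, sub_sub_cancel_left, neg_eq_zero] at h
    have hz2 : (v * u') * e = 0 := by
      have h := O.mul_conj_cancel_lin u' v e
      have hb : O.bl u' e = 0 := by
        have := O.bl_mul_left e u' 1
        rwa [mul_one, hu', hne0, zero_mul] at this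
      have hvv : v * e = v := hzee _
      rw [hvv, hb, zero_smul, hconj u' hu1', hf, mul_sub, mul_one, mul_neg] at h
      rwa [← sub_eq_add_neg, sub_sub_cancel_left, neg_eq_zero] at h
    have hz : v * u' = 0 := by
      have h := congrArg O.conj hz1
      have ht : O.bl (v * u') 1 = 0 := by
        rw [bl_mul_adj_right, one_mul, hconj u' hu1', map_neg, hbl u' hu' (hUe u' hu' hu1'), hw',
          neg_zero]
      rw [conj_mul, hconj _ ht, hf, mul_sub, mul_one, neg_mul, hz2, map_zero] at h
      simpa using h
    have h := O.conj_mul_cancel_lin u u' v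
    rw [hz, huu', mul_zero, mul_zero, add_zero, bl_comm, hbl u hu (hUe u hu hu1), hw,
      one_smul] at h
    exact hu0 h.symm
  have hrange : Module.finrank F (LinearMap.range (LinearMap.mulLeft F e)) ≤ 2 := by
    obtain ⟨u₀, hu₀⟩ : ∃ u₀, ∀ u, e * u = u → O.bl u 1 = 0 → u ∈ Submodule.span F {u₀} := by
      by_cases h : ∃ u', e * u' = u' ∧ O.bl u' 1 = 0 ∧ u' ≠ 0
      · obtain ⟨u', h1, h2, h3⟩ := h
        exact ⟨u', fun u hu hu' => hline u u' hu hu' h1 h2 h3⟩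
      · push Not at h
        exact ⟨0, fun u hu hu' => by simp [h u hu hu']⟩
    have hle : LinearMap.range (LinearMap.mulLeft F e) ≤ Submodule.span F ({e, u₀} : Set O.C) := by
      rintro _ ⟨y, rfl⟩
      rw [LinearMap.mulLeft_apply, Submodule.span_insert]
      have := hu₀ (e * y - O.bl (e * y) 1 • e)
        (by rw [mul_sub, heez, mul_smul_comm, hee]) (by simp [he1])
      rw [← sub_add_cancel (e * y) (O.bl (e * y) 1 • e), add_comm]
      exact Submodule.add_mem_sup (Submodule.smul_mem _ _ (Submodule.mem_span_singleton_self _))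
        this
    refine (Submodule.finrank_mono hle).trans ?_
    classical
    have := finrank_span_finset_le_card (R := F) ({e, u₀} : Finset O.C)
    rw [Finset.coe_pair] at this
    exact this.trans Finset.card_le_two
  have hker : Module.finrank F (LinearMap.ker (LinearMap.mulLeft F e)) ≤ 4 := by
    refine O.finrank_le_of_isotropic fun z hz => ?_
    have hz' : e * z = 0 := hz
    have : z = O.conj e * z := by rw [hf, sub_mul, one_mul, hz', sub_zero]
    rw [this, O.n_mul, n_conj, hne0, zero_mul]
  have := LinearMap.finrank_range_add_finrank_ker (LinearMap.mulLeft F e)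
  rw [O.finrank_eq] at this
  omega

end OctonionAlgebra

lemma Submodule.finrank_le_finrank_map_add_finrank_inf_ker {F E E' : Type*} [Field F]
    [AddCommGroup E] [Module F E] [FiniteDimensional F E] [AddCommGroup E'] [Module F E']
    (φ : E →ₗ[F] E') (W : Submodule F E) :
    Module.finrank F W ≤ Module.finrank F (W.map φ) + Module.finrank F ↥(W ⊓ LinearMap.ker φ) := by
  have h := LinearMap.finrank_range_add_finrank_ker (φ.domRestrict W)
  rw [LinearMap.range_domRestrict, LinearMap.ker_domRestrict,
    ← Submodule.finrank_map_subtype_eq, Submodule.map_comap_subtype] at h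
  exact h.ge

namespace OctonionAlgebra

variable {F : Type u} [Field F] (O : OctonionAlgebra.{u, v} F)

lemma herm_X (x y : O.Herm) : O.herm.X x y = O.hermX x y := rfl

lemma herm_T (x y : O.Herm) : O.herm.T x y = O.hermT x y := rfl

lemma hermX_self_eq_zero {x : O.Herm} (hx : O.hermSharp x = 0) : O.herm.X x x = 0 := by
  rw [herm_X, hermX_self, hx, smul_zero]

/-- The first diagonal idempotent. -/
def hermE : O.Herm := (1, 0, 0, 0, 0, 0)

lemma hermX_hermE : O.herm.X O.hermE O.hermE = 0 :=
  O.hermX_self_eq_zero (by simp [hermSharp, hermE])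

/-- A family of rank one elements. -/
def hermV (b c : O.C) : O.Herm := (1, O.n c, O.n b, O.conj (b * c), b, c)

lemma hermX_hermV (b c : O.C) : O.herm.X (O.hermV b c) (O.hermV b c) = 0 := by
  refine O.hermX_self_eq_zero ?_
  simp only [hermSharp, hermV, n_conj, O.n_mul, conj_mul, conj_conj, one_smul,
    mul_conj_cancel_left, conj_mul_cancel_right, map_smul, sub_self, Prod.mk_eq_zero, mul_one,
    one_mul, mul_comm (O.n c), and_self]

lemma exists_rank_one (h2 : (2 : F) ≠ 0) {d : O.Herm} (hd : d ≠ 0) :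
    ∃ h, O.herm.X h h = 0 ∧ O.herm.T h O.hermE ≠ 0 ∧ O.herm.T h d ≠ 0 := by
  by_contra! hc
  obtain ⟨p, q, r, a, b, c⟩ := d
  have key : ∀ y z, p + O.n z * q + O.n y * r + O.bl (O.conj (y * z)) a + O.bl y b
      + O.bl z c = 0 := by
    intro y z
    have := hc (O.hermV y z) (O.hermX_hermV y z) (by simp [herm_T, hermT_apply, hermV, hermE])
    simpa [herm_T, hermT_apply, hermV] using this
  have hp : p = 0 := by simpa using key 0 0
  subst hp
  have hb : b = 0 := O.bl_ext fun y => by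
    have h1 := key y 0
    have h3 := key (-y) 0
    simp at h1 h3
    rw [bl_comm, map_zero, LinearMap.zero_apply]
    exact (mul_eq_zero.1 (by linear_combination h1 - h3 : (2 : F) * O.bl y b = 0)).resolve_left h2
  have hcc : c = 0 := O.bl_ext fun y => by
    have h1 := key 0 y
    have h3 := key 0 (-y)
    simp at h1 h3
    rw [bl_comm, map_zero, LinearMap.zero_apply]
    exact (mul_eq_zero.1 (by linear_combination h1 - h3 : (2 : F) * O.bl y c = 0)).resolve_left h2
  subst hb hcc
  have hr : r = 0 := by simpa [O.n_one] using key 1 0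
  have hq : q = 0 := by simpa [O.n_one] using key 0 1
  subst hr hq
  have ha : a = 0 := O.bl_ext fun y => by
    have := key 1 (O.conj y)
    rw [bl_comm, map_zero, LinearMap.zero_apply]
    simpa [conj_conj] using this
  exact hd (by rw [ha]; rfl)

lemma span_rank_one : Submodule.span F {c : O.Herm | O.herm.X c c = 0} = ⊤ := by
  rw [eq_top_iff]
  rintro ⟨p, q, r, a, b, c⟩ -
  have mem : ∀ x : O.Herm, O.hermSharp x = 0 →
      x ∈ Submodule.span F {c : O.Herm | O.herm.X c c = 0} :=
    fun x hx => Submodule.subset_span (O.hermX_self_eq_zero hx)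
  have h0 := mem (p - 2, 0, 0, 0, 0, 0) (by simp [hermSharp])
  have h1 := mem (0, q - O.n c - 1, 0, 0, 0, 0) (by simp [hermSharp])
  have h2 := mem (0, 0, r - O.n b - O.n a, 0, 0, 0) (by simp [hermSharp])
  have ha := mem (0, 1, O.n a, a, 0, 0) (by simp [hermSharp])
  have hb := mem (1, 0, O.n b, 0, b, 0) (by simp [hermSharp])
  have hc := mem (1, O.n c, 0, 0, 0, c) (by simp [hermSharp])
  convert add_mem (add_mem (add_mem h0 h1) (add_mem h2 ha)) (add_mem hb hc) using 1
  simp only [Prod.mk_add_mk, Prod.mk.injEq]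
  refine ⟨by ring, by ring, by ring, by simp, by simp, by simp⟩

/-- The parametrization of the standard `12`-dimensional inner ideal. -/
def stdIdealMap : F × F × F × F × O.C →ₗ[F] F × O.Herm × O.Herm × F where
  toFun x := (x.1, (x.2.1, 0, 0, 0, 0, 0), (0, x.2.2.1, x.2.2.2.1, x.2.2.2.2, 0, 0), 0)
  map_add' x y := by simp
  map_smul' c x := by simp

/-- The standard `12`-dimensional inner ideal. -/
def stdIdeal : Submodule F (F × O.Herm × O.Herm × F) := LinearMap.range O.stdIdealMap

lemma finrank_stdIdeal_le : Module.finrank F O.stdIdeal ≤ 12 := by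
  refine (LinearMap.finrank_range_le _).trans ?_
  simp [Module.finrank_prod, O.finrank_eq]

variable {O} {I : Submodule F (F × O.Herm × O.Herm × F)}

lemma eq_stdIdeal (h2 : (2 : F) ≠ 0) (h3 : (3 : F) ≠ 0) (hI : O.herm.IsInner I) (hI' : I ≠ ⊤)
    (h1 : ((1, 0, 0, 0) : F × O.Herm × O.Herm × F) ∈ I)
    (he : ((0, O.hermE, 0, 0) : F × O.Herm × O.Herm × F) ∈ I) : I = O.stdIdeal := by
  have hA : ∀ q r a, ((0, 0, (0, q, r, a, 0, 0), 0) : F × O.Herm × O.Herm × F) ∈ I := by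
    intro q r a
    convert hI.cross_mem_left h2 h1 he (0, r, q, -a, 0, 0) using 4
    simp [herm_X, hermX_apply, hermE]
  have hbc : ∀ ε q r a b c, ((0, (ε, q, r, a, b, c), 0, 0) : F × O.Herm × O.Herm × F) ∈ I →
      q = 0 ∧ r = 0 ∧ a = 0 ∧ O.n b = 0 ∧ O.n c = 0 := by
    intro ε q r a b c h
    have k1 := hI.cross_eq_zero h2 h3 hI' h1 he h
    have k2 := hI.cross_eq_zero h2 h3 hI' h1 h h
    simp [herm_X, hermX_apply, hermE] at k1
    obtain ⟨rfl, rfl, rfl⟩ := k1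
    simp [herm_X, hermX_apply, bl_self, h2] at k2
    exact ⟨rfl, rfl, rfl, k2.1, k2.2.1⟩
  have hflip : ∀ b, ((0, 0, (0, 0, 0, 0, 0, b), 0) : F × O.Herm × O.Herm × F) ∈ I →
      ((0, (0, 0, 0, 0, 0, b), 0, 0) : F × O.Herm × O.Herm × F) ∈ I := by
    intro b hb
    convert I.neg_mem (hI.cross_mem_right h2 hb (hA 0 1 0)) using 1
    simp [herm_X, hermX_apply]
  let X : Submodule F O.C := I.comap
    ((LinearMap.inr F F _).comp <| (LinearMap.inl F O.Herm (O.Herm × F)).comp <|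
      (LinearMap.inr F F _).comp <| (LinearMap.inr F F _).comp <| (LinearMap.inr F F _).comp <|
      (LinearMap.inr F O.C _).comp <| LinearMap.inr F O.C O.C)
  have hX : ∀ c, c ∈ X ↔ ((0, (0, 0, 0, 0, 0, c), 0, 0) : F × O.Herm × O.Herm × F) ∈ I :=
    fun c => Iff.rfl
  have hXbot : X = ⊥ := by
    refine O.eq_bot_of_isotropic_of_mul_mem (fun c hc => (hbc _ _ _ _ _ _ hc).2.2.2.2) ?_
    intro c hc p q
    have k1 := hI.cross_mem_left h2 h1 hc (0, 0, 0, p, 0, 0)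
    have k2 := hI.cross_mem_right h2 k1 (hA 0 0 (O.conj q))
    rw [hX]
    convert k2 using 1
    simp [herm_X, hermX_apply, conj_mul, conj_conj]
  have hX0 : ∀ c, ((0, (0, 0, 0, 0, 0, c), 0, 0) : F × O.Herm × O.Herm × F) ∈ I → c = 0 :=
    fun c hc => by
      have : c ∈ X := hc
      rwa [hXbot, Submodule.mem_bot] at this
  have hB : ∀ ε q r a b c, ((0, (ε, q, r, a, b, c), 0, 0) : F × O.Herm × O.Herm × F) ∈ I →
      q = 0 ∧ r = 0 ∧ a = 0 ∧ b = 0 ∧ c = 0 := by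
    intro ε q r a b c h
    obtain ⟨rfl, rfl, rfl, -, -⟩ := hbc _ _ _ _ _ _ h
    replace h : ((0, (0, 0, 0, 0, b, c), 0, 0) : F × O.Herm × O.Herm × F) ∈ I := by
      convert I.sub_mem h (I.smul_mem ε he) using 1
      simp [hermE]
    have hc : c = 0 := by
      have k1 := hI.cross_mem_left h2 h1 h (0, 0, 1, 0, 0, 0)
      have k2 := hI.cross_mem_right h2 k1 (hA 0 1 0)
      refine hX0 c ?_
      convert k2 using 1
      simp [herm_X, hermX_apply]
    subst hc
    refine ⟨rfl, rfl, rfl, ?_, rfl⟩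
    have k1 := hI.cross_mem_left h2 h1 h (0, 0, 0, 1, 0, 0)
    have k2 := hX0 (O.conj b) (hflip _ (by
      convert k1 using 1
      simp [herm_X, hermX_apply]))
    rw [← O.conj_conj b, k2, map_zero]
  refine le_antisymm (fun x hx => ?_) ?_
  · obtain ⟨k0, k1, k2⟩ := hI.components h2 h3 hI' h1 hx
    obtain ⟨α, ⟨ε, q, r, a, b, c⟩, ⟨ε', q', r', a', b', c'⟩, β⟩ := x
    dsimp only at k0 k1 k2
    obtain ⟨rfl, rfl, rfl, rfl, rfl⟩ := hB _ _ _ _ _ _ k1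
    have l1 := hI.cross_mem_right h2 k2 (hA 1 0 0)
    have l2 := hI.cross_mem_right h2 k2 (hA 0 1 0)
    simp only [herm_X, hermX_apply] at l1 l2
    obtain ⟨-, m1, -, m2, -⟩ := hB _ _ _ _ _ _ l1
    obtain ⟨-, -, -, -, m3⟩ := hB _ _ _ _ _ _ l2
    simp at m1 m2 m3
    subst m1 m2 m3 k0
    exact ⟨(α, ε, q', r', a'), rfl⟩
  · rintro _ ⟨⟨α, ξ, q, r, a⟩, rfl⟩
    convert I.add_mem (I.add_mem (I.smul_mem α h1) (I.smul_mem ξ he)) (hA q r a) using 1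
    simp [stdIdealMap, hermE]
end OctonionAlgebra

namespace OctonionAlgebra

variable {F : Type u} [Field F] {O : OctonionAlgebra.{u, v} F}
  {I : Submodule F (F × O.Herm × O.Herm × F)}

lemma exists_isometry_move_hermE (h2 : (2 : F) ≠ 0) (h3 : (3 : F) ≠ 0) {p : O.Herm}
    (hp : O.herm.X p p = 0) (hp0 : p ≠ 0)
    (h1 : ((1, 0, 0, 0) : F × O.Herm × O.Herm × F) ∈ I) :
    ∃ f, O.herm.IsIsometry f ∧ ((1, 0, 0, 0) : F × O.Herm × O.Herm × F) ∈
        I.map (f : (F × O.Herm × O.Herm × F) →ₗ[F] (F × O.Herm × O.Herm × F)) ∧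
      ∃ s : F, s ≠ 0 ∧ f (0, p, 0, 0) = (0, s • O.hermE, 0, 0) := by
  obtain ⟨q, hq, hqe, hqp⟩ := O.exists_rank_one h2 hp0
  rw [O.herm.T_comm] at hqe
  obtain ⟨f, hf, ⟨s, hs, hfs⟩, hf'⟩ :=
    O.herm.exists_isometry_move h2 h3 hp hq O.hermX_hermE hqp hqe
  refine ⟨f, hf, ?_, hf'⟩
  rw [← Submodule.smul_mem_iff _ hs]
  exact ⟨_, h1, by simp [hfs]⟩

lemma finrank_le_of_forall_mem (h2 : (2 : F) ≠ 0) (h3 : (3 : F) ≠ 0) (hI : O.herm.IsInner I)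
    (hI' : I ≠ ⊤) (h1 : ((1, 0, 0, 0) : F × O.Herm × O.Herm × F) ∈ I)
    (hB : ∀ b, ((0, b, 0, 0) : F × O.Herm × O.Herm × F) ∈ I → b = 0) {a₀ : O.Herm}
    (ha₀ : ((0, 0, a₀, 0) : F × O.Herm × O.Herm × F) ∈ I) (h0 : a₀.1 ≠ 0) :
    Module.finrank F I ≤ 10 := by
  have hX : ∀ a a', ((0, 0, a, 0) : F × O.Herm × O.Herm × F) ∈ I →
      ((0, 0, a', 0) : F × O.Herm × O.Herm × F) ∈ I → O.hermX a a' = 0 :=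
    fun a a' ha ha' => hB _ (hI.cross_mem_right h2 ha ha')
  have hmem : ∀ x ∈ I, x.2.1 = 0 ∧ x.2.2.2 = 0 ∧
      ((0, 0, x.2.2.1, 0) : F × O.Herm × O.Herm × F) ∈ I := fun x hx => by
    obtain ⟨k0, k1, k2⟩ := hI.components h2 h3 hI' h1 hx
    exact ⟨hB _ k1, k0, k2⟩
  let π : (F × O.Herm × O.Herm × F) →ₗ[F] O.Herm :=
    (LinearMap.fst F _ _).comp ((LinearMap.snd F _ _).comp (LinearMap.snd F _ _))
  let φ₁ : (F × O.Herm × O.Herm × F) →ₗ[F] F := LinearMap.fst F _ _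
  let φ₂ : (F × O.Herm × O.Herm × F) →ₗ[F] F := (LinearMap.fst F _ _).comp π
  let φ₃ : (F × O.Herm × O.Herm × F) →ₗ[F] O.C := (LinearMap.fst F _ _).comp <|
    (LinearMap.snd F _ _).comp <| (LinearMap.snd F _ _).comp <| (LinearMap.snd F _ _).comp <|
    (LinearMap.snd F _ _).comp π
  let φ₄ : (F × O.Herm × O.Herm × F) →ₗ[F] O.C :=
    (LinearMap.snd F _ _).comp <|
    (LinearMap.snd F _ _).comp <| (LinearMap.snd F _ _).comp <| (LinearMap.snd F _ _).comp <|
    (LinearMap.snd F _ _).comp π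
  have hsq : ∀ x ∈ I, x.2.2.1.1 = 0 → O.n x.2.2.1.2.2.2.2.1 = 0 ∧ O.n x.2.2.1.2.2.2.2.2 = 0 := by
    intro x hx hx0
    have := hX _ _ (hmem x hx).2.2 (hmem x hx).2.2
    simp only [hermX_apply, hx0, bl_self, Prod.mk_eq_zero] at this
    simpa [h2] using And.intro this.2.1 this.2.2.1
  have k1 := Submodule.finrank_le_finrank_map_add_finrank_inf_ker φ₁ I
  have k2 := Submodule.finrank_le_finrank_map_add_finrank_inf_ker φ₂ (I ⊓ LinearMap.ker φ₁)
  have k3 := Submodule.finrank_le_finrank_map_add_finrank_inf_ker φ₃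
    (I ⊓ LinearMap.ker φ₁ ⊓ LinearMap.ker φ₂)
  have k4 := Submodule.finrank_le_finrank_map_add_finrank_inf_ker φ₄
    (I ⊓ LinearMap.ker φ₁ ⊓ LinearMap.ker φ₂ ⊓ LinearMap.ker φ₃)
  have l1 := Submodule.finrank_le (I.map φ₁)
  have l2 := Submodule.finrank_le ((I ⊓ LinearMap.ker φ₁).map φ₂)
  have l3 := O.finrank_le_of_isotropic
    (W := (I ⊓ LinearMap.ker φ₁ ⊓ LinearMap.ker φ₂).map φ₃) (by
      rintro _ ⟨x, hx, rfl⟩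
      exact (hsq x hx.1.1 hx.2).1)
  have l4 := O.finrank_le_of_isotropic
    (W := (I ⊓ LinearMap.ker φ₁ ⊓ LinearMap.ker φ₂ ⊓ LinearMap.ker φ₃).map φ₄) (by
      rintro _ ⟨x, hx, rfl⟩
      exact (hsq x hx.1.1.1 hx.1.2).2)
  have l5 : I ⊓ LinearMap.ker φ₁ ⊓ LinearMap.ker φ₂ ⊓ LinearMap.ker φ₃ ⊓ LinearMap.ker φ₄ = ⊥ := by
    rw [eq_bot_iff]
    rintro ⟨α, b, ⟨p, q, r, a, b', c'⟩, β⟩ ⟨⟨⟨⟨hx, e1⟩, e2⟩, e3⟩, e4⟩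
    obtain ⟨m1, m2, m3⟩ := hmem _ hx
    change α = 0 at e1
    change p = 0 at e2
    change b' = 0 at e3
    change c' = 0 at e4
    dsimp only at m1 m2 m3
    subst e1 e2 e3 e4 m1 m2
    have := hX _ _ ha₀ m3
    simp [hermX_apply, h0] at this
    obtain ⟨n1, n2, n3, n4, -⟩ := this
    subst n2 n3 n4
    rfl
  rw [l5, finrank_bot] at k4
  rw [Module.finrank_self] at l1 l2
  omega

lemma exists_isometry_map_eq_stdIdeal (h2 : (2 : F) ≠ 0) (h3 : (3 : F) ≠ 0)
    (hI : O.herm.IsInner I) (hI' : I ≠ ⊤) (h11 : 11 ≤ Module.finrank F I) :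
    ∃ f, O.herm.IsIsometry f ∧
      I.map (f : (F × O.Herm × O.Herm × F) →ₗ[F] (F × O.Herm × O.Herm × F)) = O.stdIdeal := by
  have hbot : I ≠ ⊥ := by
    rintro rfl
    simp at h11
  obtain ⟨f, hf, h1⟩ := hI.exists_isometry_mem h2 h3 O.span_rank_one hbot
  have map_ne : ∀ (I : Submodule F (F × O.Herm × O.Herm × F))
      (f : (F × O.Herm × O.Herm × F) ≃ₗ[F] (F × O.Herm × O.Herm × F)), I ≠ ⊤ →
      I.map (f : (F × O.Herm × O.Herm × F) →ₗ[F] (F × O.Herm × O.Herm × F)) ≠ ⊤ := by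
    intro I f hI h
    exact hI ((Submodule.map_eq_top_iff).1 h)
  have move : ∀ (f : (F × O.Herm × O.Herm × F) ≃ₗ[F] (F × O.Herm × O.Herm × F)),
      O.herm.IsIsometry f → ((1, 0, 0, 0) : F × O.Herm × O.Herm × F) ∈
        I.map (f : (F × O.Herm × O.Herm × F) →ₗ[F] (F × O.Herm × O.Herm × F)) →
      ∀ b, b ≠ 0 → ((0, b, 0, 0) : F × O.Herm × O.Herm × F) ∈
        I.map (f : (F × O.Herm × O.Herm × F) →ₗ[F] (F × O.Herm × O.Herm × F)) →
      ∃ f, O.herm.IsIsometry f ∧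
        I.map (f : (F × O.Herm × O.Herm × F) →ₗ[F] (F × O.Herm × O.Herm × F)) = O.stdIdeal := by
    intro f hf h1 b hb hbI
    obtain ⟨g, hg, hg1, s, hs, hgs⟩ := exists_isometry_move_hermE h2 h3
      ((hI.map hf).cross_eq_zero h2 h3 (map_ne _ f hI') h1 hbI hbI) hb h1
    refine ⟨f.trans g, hf.trans _ hg, ?_⟩
    rw [LinearEquiv.coe_trans, Submodule.map_comp]
    refine eq_stdIdeal h2 h3 ((hI.map hf).map hg) (map_ne _ g (map_ne _ f hI')) hg1 ?_
    rw [← Submodule.smul_mem_iff _ hs]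
    exact ⟨_, hbI, by simp [hgs]⟩
  by_contra hno
  have noB : ∀ (f : (F × O.Herm × O.Herm × F) ≃ₗ[F] (F × O.Herm × O.Herm × F)),
      O.herm.IsIsometry f → ((1, 0, 0, 0) : F × O.Herm × O.Herm × F) ∈
        I.map (f : (F × O.Herm × O.Herm × F) →ₗ[F] (F × O.Herm × O.Herm × F)) →
      ∀ b, ((0, b, 0, 0) : F × O.Herm × O.Herm × F) ∈
        I.map (f : (F × O.Herm × O.Herm × F) →ₗ[F] (F × O.Herm × O.Herm × F)) → b = 0 := by
    intro f hf h1 b hb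
    by_contra hb0
    exact hno (move f hf h1 b hb0 hb)
  have hfr : ∀ f : (F × O.Herm × O.Herm × F) ≃ₗ[F] (F × O.Herm × O.Herm × F), Module.finrank F
      (I.map (f : (F × O.Herm × O.Herm × F) →ₗ[F] (F × O.Herm × O.Herm × F))) =
      Module.finrank F I := fun f => f.finrank_map_eq I
  by_cases hA : ∃ a : O.Herm, a ≠ 0 ∧ ((0, 0, a, 0) : F × O.Herm × O.Herm × F) ∈
      I.map (f : (F × O.Herm × O.Herm × F) →ₗ[F] (F × O.Herm × O.Herm × F))
  · obtain ⟨a, ha, haI⟩ := hA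
    obtain ⟨p, hp, -, hpa⟩ := O.exists_rank_one h2 ha
    obtain ⟨g, hg, hg1, s, hs, hgs⟩ := exists_isometry_move_hermE h2 h3 hp
      (by rintro rfl; simp at hpa) h1
    have hfg := hf.trans _ hg
    have hmm : ∀ x ∈ I.map (f : (F × O.Herm × O.Herm × F) →ₗ[F] (F × O.Herm × O.Herm × F)),
        g x ∈ I.map ((f.trans g : (F × O.Herm × O.Herm × F) ≃ₗ[F] _) :
          (F × O.Herm × O.Herm × F) →ₗ[F] (F × O.Herm × O.Herm × F)) := by
      rintro _ ⟨x, hx, rfl⟩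
      exact ⟨x, hx, rfl⟩
    have hg1' : ((1, 0, 0, 0) : F × O.Herm × O.Herm × F) ∈ I.map
        ((f.trans g : (F × O.Herm × O.Herm × F) ≃ₗ[F] _) :
          (F × O.Herm × O.Herm × F) →ₗ[F] (F × O.Herm × O.Herm × F)) := by
      rw [LinearEquiv.coe_trans, Submodule.map_comp]
      exact hg1
    have hga := (hI.map hfg).components h2 h3 (map_ne _ _ hI') hg1' (hmm _ haI)
    have hsk := hg.1 (0, p, 0, 0) (0, 0, a, 0)
    have := finrank_le_of_forall_mem h2 h3 (hI.map hfg) (map_ne _ _ hI') hg1'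
      (noB _ hfg hg1') hga.2.2 (by
        intro h0
        rw [hgs] at hsk
        simp [CubicStructure.skew, herm_T, hermT_apply, hermE, h0] at hsk
        exact hpa (by rw [herm_T, hermT_apply]; exact hsk.symm))
    rw [hfr] at this
    omega
  · push Not at hA
    have hle : I.map (f : (F × O.Herm × O.Herm × F) →ₗ[F] (F × O.Herm × O.Herm × F)) ≤
        Submodule.span F {(1, 0, 0, 0)} := by
      intro x hx
      obtain ⟨k0, k1, k2⟩ := (hI.map hf).components h2 h3 (map_ne _ f hI') h1 hx
      have e1 := noB f hf h1 _ k1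
      have e2 : x.2.2.1 = 0 := by
        by_contra h
        exact hA _ h k2
      exact Submodule.mem_span_singleton.2 ⟨x.1, by ext <;> simp [k0, e1, e2]⟩
    have := (Submodule.finrank_mono hle).trans (finrank_span_le_card _)
    rw [hfr] at this
    simp at this
    omega

lemma finrank_le_of_isInner (h2 : (2 : F) ≠ 0) (h3 : (3 : F) ≠ 0)
    (hI : O.herm.IsInner I) (hI' : I ≠ ⊤) : Module.finrank F I ≤ 12 := by
  by_contra! h
  obtain ⟨f, -, hf⟩ := exists_isometry_map_eq_stdIdeal h2 h3 hI hI' (by omega)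
  have := O.finrank_stdIdeal_le
  rw [← hf, f.finrank_map_eq] at this
  omega

end OctonionAlgebra

namespace OctonionAlgebra

variable {F : Type u} [Field F] (O : OctonionAlgebra.{u, v} F)

lemma hermX_eq_sub (h2 : (2 : F) ≠ 0) (x y : O.Herm) :
    O.hermX x y = O.hermSharp (x + y) - O.hermSharp x - O.hermSharp y := by
  have h : (2 : F) • O.hermX x y =
      (2 : F) • (O.hermSharp (x + y) - O.hermSharp x - O.hermSharp y) := by
    rw [smul_sub, smul_sub, ← hermX_self, ← hermX_self, ← hermX_self]
    simp only [map_add, LinearMap.add_apply, ← herm_X, O.herm.X_comm y x]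
    module
  exact smul_right_injective _ h2 h

end OctonionAlgebra

namespace ReducedAlbert

variable {F : Type u} [Field F] (A : ReducedAlbert.{u, v} F)

/-- The hermitian matrix with given coordinates. -/
def emb : A.O.Herm →ₗ[F] A.M where
  toFun x := Matrix.of
    ![![x.1 • (1 : A.O.C), x.2.2.2.2.2, A.O.conj x.2.2.2.2.1],
      ![A.O.conj x.2.2.2.2.2, x.2.1 • (1 : A.O.C), x.2.2.2.1],
      ![x.2.2.2.2.1, A.O.conj x.2.2.2.1, x.2.2.1 • (1 : A.O.C)]]
  map_add' x y := by
    ext i j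
    fin_cases i <;> fin_cases j <;> simp [add_smul]
  map_smul' c x := by
    ext i j
    fin_cases i <;> fin_cases j <;> simp [mul_smul]

lemma emb_apply (x : A.O.Herm) : A.emb x = Matrix.of
    ![![x.1 • (1 : A.O.C), x.2.2.2.2.2, A.O.conj x.2.2.2.2.1],
      ![A.O.conj x.2.2.2.2.2, x.2.1 • (1 : A.O.C), x.2.2.2.1],
      ![x.2.2.2.2.1, A.O.conj x.2.2.2.1, x.2.2.1 • (1 : A.O.C)]] := rfl

lemma one_ne_zero_octonion : (1 : A.O.C) ≠ 0 := fun h => by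
  have := A.O.n_one
  rw [h, QuadraticMap.map_zero] at this
  exact zero_ne_one this

lemma emb_injective : Function.Injective A.emb := by
  rw [← LinearMap.ker_eq_bot, LinearMap.ker_eq_bot']
  rintro ⟨p, q, r, a, b, c⟩ h
  have e : ∀ i j, A.emb (p, q, r, a, b, c) i j = 0 := fun i j => by rw [h]; rfl
  have h1 := e 0 0
  have h2 := e 1 1
  have h3 := e 2 2
  have h4 := e 1 2
  have h5 := e 2 0
  have h6 := e 0 1
  simp [emb_apply, A.one_ne_zero_octonion] at h1 h2 h3 h4 h5 h6
  rw [h1, h2, h3, h4, h5, h6]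
  rfl

variable {A}

lemma range_emb (h2 : (2 : F) ≠ 0) (hγ : ∀ i, A.γ i = 1) : LinearMap.range A.emb = A.J := by
  have hJ : ∀ x : A.M, x ∈ A.J ↔ ∀ i j, x i j = A.O.conj (x j i) := fun x => by
    change (∀ i j, _) ↔ _
    simp [hγ]
  ext x
  rw [hJ]
  constructor
  · rintro ⟨y, rfl⟩ i j
    fin_cases i <;> fin_cases j <;> simp [emb_apply, A.O.conj_one, A.O.conj_conj]
  · intro hx
    have hd : ∀ i, x i i = ((2 : F)⁻¹ * A.O.bl (x i i) 1) • (1 : A.O.C) := fun i => by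
      have h := hx i i
      rw [A.O.conj_eq, eq_sub_iff_add_eq, ← two_smul F] at h
      rw [mul_smul, ← h, inv_smul_smul₀ h2]
    refine ⟨((2 : F)⁻¹ * A.O.bl (x 0 0) 1, (2 : F)⁻¹ * A.O.bl (x 1 1) 1,
      (2 : F)⁻¹ * A.O.bl (x 2 2) 1, x 1 2, x 2 0, x 0 1), ?_⟩
    ext i j
    rw [emb_apply]
    fin_cases i <;> fin_cases j
    · exact (hd 0).symm
    · rfl
    · exact (hx 0 2).symm
    · exact (hx 1 0).symm
    · exact (hd 1).symm
    · rfl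
    · rfl
    · exact (hx 2 1).symm
    · exact (hd 2).symm

lemma trace_eq (x : A.M) : A.trace x =
    (2 : F)⁻¹ * (A.O.bl (x 0 0) 1 + A.O.bl (x 1 1) 1 + A.O.bl (x 2 2) 1) := by
  rw [trace, Fin.sum_univ_three]
  rfl

lemma trace_emb (h2 : (2 : F) ≠ 0) (x : A.O.Herm) : A.trace (A.emb x) = x.1 + x.2.1 + x.2.2.1 := by
  rw [trace_eq]
  simp [emb_apply, A.O.bl_one_one]
  field_simp

lemma jmul_apply (x y : A.M) (i j : Fin 3) : A.jmul x y i j = (2 : F)⁻¹ •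
    ((x i 0 * y 0 j + x i 1 * y 1 j + x i 2 * y 2 j)
      + (y i 0 * x 0 j + y i 1 * x 1 j + y i 2 * x 2 j)) := by
  simp [jmul, Matrix.mul_apply, Fin.sum_univ_three]

lemma tb_emb (h2 : (2 : F) ≠ 0) (x y : A.O.Herm) :
    A.tb (A.emb x) (A.emb y) = A.O.hermT x y := by
  rw [tb, trace_eq, jmul_apply, jmul_apply, jmul_apply, A.O.hermT_apply]
  simp [emb_apply, A.O.bl_one_one, A.O.bl_mul_adj_right _ _ (1 : A.O.C), A.O.conj_conj,
    A.O.bl_conj_conj]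
  rw [A.O.bl_comm y.2.2.2.1, A.O.bl_comm y.2.2.2.2.1, A.O.bl_comm y.2.2.2.2.2]
  field_simp
  ring

lemma sharp_emb (h2 : (2 : F) ≠ 0) (x : A.O.Herm) :
    A.sharp (A.emb x) = A.emb (A.O.hermSharp x) := by
  obtain ⟨p, q, r, a, b, c⟩ := x
  have hs : ∀ y : A.O.C, (2 : F)⁻¹ • (y + y) = y := fun y => by
    rw [← two_smul F, inv_smul_smul₀ h2]
  ext i j
  rw [sharp, Matrix.add_apply, Matrix.sub_apply, jmul_apply, hs, tb_emb h2, trace_emb h2,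
    A.O.hermT_apply]
  have hq : (2 : F)⁻¹ * ((p + q + r) ^ 2
      - (p * p + q * q + r * r + 2 * A.O.n a + 2 * A.O.n b + 2 * A.O.n c))
      = p * q + q * r + r * p - A.O.n a - A.O.n b - A.O.n c := by
    field_simp
    ring
  simp only [A.O.bl_self, hq]
  fin_cases i <;> fin_cases j <;>
    simp [emb_apply, OctonionAlgebra.hermSharp, A.O.conj_mul, A.O.conj_conj,
      A.O.mul_conj_self, A.O.conj_mul_self] <;>
    module

lemma cross_emb (h2 : (2 : F) ≠ 0) (x y : A.O.Herm) :
    A.cross (A.emb x) (A.emb y) = A.emb (A.O.hermX x y) := by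
  rw [cross, ← map_add, sharp_emb h2, sharp_emb h2, sharp_emb h2, A.O.hermX_eq_sub h2, map_sub,
    map_sub]

variable (A) in
/-- The inclusion of the coordinate model of the Brown algebra in the ambient space. -/
def brownEmb : (F × A.O.Herm × A.O.Herm × F) →ₗ[F] A.Bam :=
  LinearMap.prodMap LinearMap.id (LinearMap.prodMap A.emb (LinearMap.prodMap A.emb LinearMap.id))

lemma brownEmb_apply (x : F × A.O.Herm × A.O.Herm × F) :
    A.brownEmb x = (x.1, A.emb x.2.1, A.emb x.2.2.1, x.2.2.2) := rfl

variable (A) in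
lemma brownEmb_injective : Function.Injective A.brownEmb := by
  intro x y h
  simp only [brownEmb_apply, Prod.mk.injEq, A.emb_injective.eq_iff] at h
  ext1
  · exact h.1
  · ext1
    · exact h.2.1
    · ext1
      · exact h.2.2.1
      · exact h.2.2.2

lemma range_brownEmb (h2 : (2 : F) ≠ 0) (hγ : ∀ i, A.γ i = 1) :
    LinearMap.range A.brownEmb = A.Bsub := by
  have hJ := range_emb h2 hγ
  ext x
  change _ ↔ (x.2.1 ∈ A.J ∧ x.2.2.1 ∈ A.J)
  rw [← hJ]
  constructor
  · rintro ⟨y, rfl⟩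
    exact ⟨⟨_, rfl⟩, ⟨_, rfl⟩⟩
  · rintro ⟨⟨y, hy⟩, ⟨z, hz⟩⟩
    exact ⟨(x.1, y, z, x.2.2.2), by rw [brownEmb_apply, hy, hz]⟩

lemma bmul_brownEmb (h2 : (2 : F) ≠ 0) (x y : F × A.O.Herm × A.O.Herm × F) :
    A.bmul 1 (A.brownEmb x) (A.brownEmb y) = A.brownEmb
      (x.1 * y.1 + A.O.herm.T x.2.1 y.2.2.1,
        x.1 • y.2.1 + y.2.2.2 • x.2.1 + A.O.herm.X x.2.2.1 y.2.2.1,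
        y.1 • x.2.2.1 + x.2.2.2 • y.2.2.1 + A.O.herm.X x.2.1 y.2.1,
        x.2.2.2 * y.2.2.2 + A.O.herm.T y.2.1 x.2.2.1) := by
  simp [bmul, brownEmb_apply, tb_emb h2, cross_emb h2, A.O.herm_X, A.O.herm_T]

lemma binv_brownEmb (x : F × A.O.Herm × A.O.Herm × F) :
    A.binv (A.brownEmb x) = A.brownEmb (x.2.2.2, x.2.1, x.2.2.1, x.1) := rfl

variable (A) in
lemma s0_eq : A.s0 = A.brownEmb (1, 0, 0, -1) := by
  simp [brownEmb_apply, s0]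

lemma bform_brownEmb (h2 : (2 : F) ≠ 0) (x y : F × A.O.Herm × A.O.Herm × F) :
    A.bform 1 (A.brownEmb x) (A.brownEmb y) = A.O.herm.skew x y := by
  rw [bform, bformS, s0_eq, binv_brownEmb, binv_brownEmb, bmul_brownEmb h2, bmul_brownEmb h2,
    ← map_sub, bmul_brownEmb h2, brownEmb_apply]
  simp [CubicStructure.skew]
  ring

lemma bmul_s0_brownEmb (h2 : (2 : F) ≠ 0) (x : F × A.O.Herm × A.O.Herm × F) :
    A.bmul 1 A.s0 (A.brownEmb x) = A.brownEmb (x.1, x.2.1, -x.2.2.1, -x.2.2.2) := by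
  rw [s0_eq, bmul_brownEmb h2]
  simp

lemma tform_brownEmb (h2 : (2 : F) ≠ 0) (x y z : F × A.O.Herm × A.O.Herm × F) :
    A.tform 1 (A.brownEmb x) (A.brownEmb y) (A.brownEmb z)
      = A.brownEmb (A.O.herm.tri x y z) := by
  have hb : ∀ x y, A.bformS 1 A.s0 (A.brownEmb x) (A.brownEmb y) = A.O.herm.skew x y :=
    bform_brownEmb h2
  rw [tform, tformS, hb, hb, hb, bmul_s0_brownEmb h2, brace]
  simp only [binv_brownEmb, bmul_brownEmb h2, ← map_add, ← map_sub, ← map_smul]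
  congr 1
  obtain ⟨α, b, a, β⟩ := x
  obtain ⟨α', b', a', β'⟩ := y
  obtain ⟨α'', b'', a'', β''⟩ := z
  have t1 : A.O.herm.T (A.O.herm.X a'' a) a' = A.O.herm.T (A.O.herm.X a a') a'' := by
    rw [A.O.herm.T_X, A.O.herm.T_comm]
  have t2 : A.O.herm.T (A.O.herm.X a'' a') a = A.O.herm.T (A.O.herm.X a a') a'' := by
    rw [A.O.herm.T_X, A.O.herm.T_comm, A.O.herm.X_comm a' a]
  have t3 : A.O.herm.T b' (A.O.herm.X b'' b) = A.O.herm.T (A.O.herm.X b b') b'' := by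
    rw [← A.O.herm.T_X, A.O.herm.X_comm b' b'', A.O.herm.T_X, A.O.herm.T_comm,
      A.O.herm.X_comm b' b]
  have t4 : A.O.herm.T b'' (A.O.herm.X b b') = A.O.herm.T (A.O.herm.X b b') b'' :=
    A.O.herm.T_comm _ _
  have t5 : A.O.herm.T b (A.O.herm.X b'' b') = A.O.herm.T (A.O.herm.X b b') b'' := by
    rw [A.O.herm.T_X, A.O.herm.X_comm]
  have x1 := A.O.herm.X_comm a'' a
  have x2 := A.O.herm.X_comm a'' a'
  have x3 := A.O.herm.X_comm a' a
  have x4 := A.O.herm.X_comm b'' b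
  have x5 := A.O.herm.X_comm b'' b'
  have x6 := A.O.herm.X_comm b' b
  refine Prod.ext ?_ (Prod.ext ?_ (Prod.ext ?_ ?_)) <;>
    simp only [CubicStructure.tri, CubicStructure.skew, Prod.smul_mk, Prod.mk_add_mk,
      Prod.mk_sub_mk, map_add, map_smul, map_neg, LinearMap.add_apply, LinearMap.smul_apply,
      LinearMap.neg_apply, smul_eq_mul]
  · rw [t1, t2]
    ring
  · simp only [x1, x2, x3, x4, x5]
    rw [A.O.herm.X_comm (A.O.herm.X b b') a'', A.O.herm.X_comm (A.O.herm.X b' b'') a,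
      A.O.herm.X_comm (A.O.herm.X b b'') a']
    module
  · simp only [x1, x2, x4, x5, x6]
    rw [A.O.herm.X_comm (A.O.herm.X a a') b'', A.O.herm.X_comm (A.O.herm.X a' a'') b,
      A.O.herm.X_comm (A.O.herm.X a a'') b']
    module
  · rw [t3, t4, t5]
    ring

end ReducedAlbert

namespace CubicStructure

variable {F J : Type*} [Field F] [AddCommGroup J] [Module F J] (S : CubicStructure F J)

lemma isInner_span (h2 : (2 : F) ≠ 0) {s t : Set (F × J × J × F)}
    (hs : ∀ x ∈ s, ∀ y ∈ s, x + y ∈ s) (ht : Submodule.span F t = ⊤)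
    (h : ∀ e ∈ s, ∀ z ∈ t, S.tri e e z ∈ Submodule.span F s) : S.IsInner (Submodule.span F s) := by
  have h' : ∀ e ∈ s, ∀ z, S.tri e e z ∈ Submodule.span F s := by
    intro e he z
    induction ht.ge (Submodule.mem_top : z ∈ ⊤) using Submodule.span_induction with
    | mem z hz => exact h e he z hz
    | zero =>
      rw [← zero_smul F (0 : F × J × J × F), tri_smul_right, zero_smul]
      exact zero_mem _
    | add z z' _ _ hz hz' => rw [tri_add_right]; exact add_mem hz hz'
    | smul c z _ hz => rw [tri_smul_right]; exact Submodule.smul_mem _ c hz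
  have h'' : ∀ x ∈ s, ∀ y ∈ s, ∀ z, S.tri x y z ∈ Submodule.span F s := by
    intro x hx y hy z
    have hxy := h' (x + y) (hs x hx y hy) z
    rw [tri_add_left, tri_add_mid, tri_add_mid, S.tri_swap y x,
      show S.tri x x z + S.tri x y z + (S.tri x y z + S.tri y y z)
        = (2 : F) • S.tri x y z + (S.tri x x z + S.tri y y z) by module] at hxy
    exact (Submodule.smul_mem_iff _ h2).1
      ((Submodule.add_mem_iff_left _ (add_mem (h' x hx z) (h' y hy z))).1 hxy)
  intro x hx y hy z
  induction hx, hy using Submodule.span_induction₂ with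
  | mem_mem x y hx hy => exact h'' x hx y hy z
  | zero_left y _ =>
    rw [← zero_smul F (0 : F × J × J × F), tri_smul_left, zero_smul]
    exact zero_mem _
  | zero_right x _ =>
    rw [← zero_smul F (0 : F × J × J × F), tri_smul_mid, zero_smul]
    exact zero_mem _
  | add_left x y w _ _ _ hx hy => rw [tri_add_left]; exact add_mem hx hy
  | add_right x y w _ _ _ hx hy => rw [tri_add_mid]; exact add_mem hx hy
  | smul_left c x y _ _ hx => rw [tri_smul_left]; exact Submodule.smul_mem _ c hx
  | smul_right c x y _ _ hx => rw [tri_smul_mid]; exact Submodule.smul_mem _ c hx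

lemma isInner_of_forall_tri_self (h2 : (2 : F) ≠ 0) {I : Submodule F (F × J × J × F)}
    (h : ∀ e ∈ I, ∀ z, S.tri e e z ∈ I) : S.IsInner I := by
  have := S.isInner_span h2 (s := I) (t := Set.univ) (fun _ hx _ hy => I.add_mem hx hy)
    Submodule.span_univ (fun e he z _ => by rw [Submodule.span_eq]; exact h e he z)
  rwa [Submodule.span_eq] at this

/-- The action of a skew-symmetric element on the Brown algebra. -/
def skewAct : (F × J × J × F) ≃ₗ[F] (F × J × J × F) where
  toFun x := (x.1, x.2.1, -x.2.2.1, -x.2.2.2)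
  invFun x := (x.1, x.2.1, -x.2.2.1, -x.2.2.2)
  map_add' x y := by simp [add_comm]
  map_smul' c x := by simp
  left_inv x := by simp
  right_inv x := by simp

end CubicStructure

namespace ReducedAlbert

variable {F : Type u} [Field F] {A : ReducedAlbert.{u, v} F}

lemma brownEmb_tri_skewAct (h2 : (2 : F) ≠ 0) (e z : F × A.O.Herm × A.O.Herm × F) :
    A.brownEmb (A.O.herm.tri e e (CubicStructure.skewAct z))
      = (2 : F) • A.brace 1 (A.brownEmb e) (A.brownEmb z) (A.brownEmb e)
        - (2 * A.O.herm.skew (CubicStructure.skewAct z) e) • A.brownEmb e := by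
  have hb : ∀ x y, A.bformS 1 A.s0 (A.brownEmb x) (A.brownEmb y) = A.O.herm.skew x y :=
    bform_brownEmb h2
  have hs : A.bmul 1 A.s0 (A.brownEmb (CubicStructure.skewAct z)) = A.brownEmb z := by
    rw [bmul_s0_brownEmb h2]
    simp [CubicStructure.skewAct]
  have he : A.O.herm.skew e e = 0 := by
    simp [CubicStructure.skew]
  rw [A.O.herm.tri_swap', ← tform_brownEmb h2, tform, tformS, hb, hb, hs, he]
  module

end ReducedAlbert

lemma BrownAlgebra.finrank_le_of_isInnerIdealA {F : Type u} [Field F] (h2 : (2 : F) ≠ 0)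
    (h3 : (3 : F) ≠ 0) (Br : BrownAlgebra F) {I : Submodule F Br.B} (hI : Br.IsInnerIdealA I)
    (hI' : I ≠ ⊤) : Module.finrank F I ≤ 12 := by
  obtain ⟨A, hA, f, hf, hf', hmul, hinv⟩ := Br.split
  have h2' : (2 : Fsep F) ≠ 0 := by
    have := (map_ne_zero (algebraMap F (Fsep F))).2 h2
    rwa [map_ofNat] at this
  have h3' : (3 : Fsep F) ≠ 0 := by
    have := (map_ne_zero (algebraMap F (Fsep F))).2 h3
    rwa [map_ofNat] at this
  let g : Fsep F ⊗[F] Br.B ≃ₗ[Fsep F] Fsep F × A.O.Herm × A.O.Herm × Fsep F :=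
    (LinearEquiv.ofInjective f hf).trans ((LinearEquiv.ofEq _ _
      (hf'.trans (ReducedAlbert.range_brownEmb h2' hA.2).symm)).trans
        (LinearEquiv.ofInjective A.brownEmb A.brownEmb_injective).symm)
  have hg : ∀ t, A.brownEmb (g t) = f t := fun t => by
    have := LinearEquiv.ofInjective_symm_apply A.brownEmb (h := A.brownEmb_injective)
      (LinearEquiv.ofEq _ _ (hf'.trans (ReducedAlbert.range_brownEmb h2' hA.2).symm)
        (LinearEquiv.ofInjective f hf t))
    exact this
  have hbrace : ∀ x y z : Br.B, f ((1 : Fsep F) ⊗ₜ[F] Br.braceA x y z)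
      = A.brace 1 (f (1 ⊗ₜ x)) (f (1 ⊗ₜ y)) (f (1 ⊗ₜ z)) := fun x y z => by
    simp only [BrownAlgebra.braceA, ReducedAlbert.brace, TensorProduct.tmul_add,
      TensorProduct.tmul_sub, map_add, map_sub, hmul, hinv]
  let N := I.baseChange (Fsep F)
  have hN : N.map g.toLinearMap
      = Submodule.span (Fsep F) ((fun i : Br.B => g ((1 : Fsep F) ⊗ₜ[F] i)) '' I) := by
    rw [show N = _ from Submodule.baseChange_eq_span _ _, Submodule.map_span]
    congr 1
    ext
    simp
  have hfin : Module.finrank (Fsep F) N = Module.finrank F I := by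
    rw [← (Submodule.toBaseChange.toLinearEquiv (Fsep F) I).finrank_eq, Module.finrank_baseChange]
  have hfin' : Module.finrank (Fsep F) (N.map g.toLinearMap) = Module.finrank F I := by
    rw [← hfin]
    exact (g.submoduleMap N).symm.finrank_eq
  have : FiniteDimensional F Br.B := Module.finite_of_finrank_pos (by rw [Br.finrank56]; norm_num)
  rw [← hfin']
  apply OctonionAlgebra.finrank_le_of_isInner h2' h3'
  · rw [hN]
    refine A.O.herm.isInner_span h2' (t := Set.range fun x : Br.B =>
      CubicStructure.skewAct (g ((1 : Fsep F) ⊗ₜ[F] x))) ?_ ?_ ?_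
    · rintro _ ⟨i, hi, rfl⟩ _ ⟨i', hi', rfl⟩
      exact ⟨i + i', I.add_mem hi hi', by simp [TensorProduct.tmul_add]⟩
    · have hB : Submodule.span (Fsep F) (Set.range fun x : Br.B => (1 : Fsep F) ⊗ₜ[F] x) = ⊤ := by
        rw [← Submodule.baseChange_top (R := F) (M := Br.B) (Fsep F), Submodule.baseChange_eq_span]
        congr 1
        ext
        simp
      have := congrArg (Submodule.map
        (g.trans CubicStructure.skewAct).toLinearMap) hB
      rw [Submodule.map_span, Submodule.map_top, LinearEquiv.range, ← Set.range_comp] at this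
      exact this
    · rintro _ ⟨i, hi, rfl⟩ _ ⟨x, rfl⟩
      have key : A.O.herm.tri (g (1 ⊗ₜ i)) (g (1 ⊗ₜ i)) (CubicStructure.skewAct (g (1 ⊗ₜ x)))
          = (2 : Fsep F) • g (1 ⊗ₜ Br.braceA i x i) - (2 * A.O.herm.skew
            (CubicStructure.skewAct (g (1 ⊗ₜ x))) (g (1 ⊗ₜ i))) • g (1 ⊗ₜ i) := by
        apply A.brownEmb_injective
        rw [ReducedAlbert.brownEmb_tri_skewAct h2', map_sub, map_smul, map_smul, hg, hg, hg,
          hbrace]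
      rw [key]
      exact sub_mem (Submodule.smul_mem _ _ (Submodule.subset_span ⟨_, hI i hi x, rfl⟩))
        (Submodule.smul_mem _ _ (Submodule.subset_span ⟨i, hi, rfl⟩))
  · intro h
    apply hI'
    apply Submodule.eq_top_of_finrank_eq
    rw [← hfin', h, finrank_top, ← g.finrank_eq, Module.finrank_baseChange]

lemma ReducedAlbert.exists_isometry_of_isInnerIdeal {F : Type u} [Field F] (h2 : (2 : F) ≠ 0)
    (h3 : (3 : F) ≠ 0) {A : ReducedAlbert.{u, v} F} (hA : ∀ i, A.γ i = 1)
    {I : Submodule F A.Bam} (hI : A.IsInnerIdeal 1 I) (hI' : I ≠ A.Bsub)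
    (h12 : Module.finrank F I = 12) :
    ∃ f : A.Bam →ₗ[F] A.Bam,
      Set.BijOn f (A.Bsub : Set A.Bam) (A.Bsub : Set A.Bam) ∧
      (∀ x ∈ A.Bsub, ∀ y ∈ A.Bsub, A.bform 1 (f x) (f y) = A.bform 1 x y) ∧
      (∀ x ∈ A.Bsub, ∀ y ∈ A.Bsub, ∀ z ∈ A.Bsub,
        A.tform 1 (f x) (f y) (f z) = f (A.tform 1 x y z)) ∧
      (∃ d ∈ A.J, d ≠ 0 ∧ A.sharp d = 0 ∧
        f '' (I : Set A.Bam)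
          = {p : A.Bam | ∃ α ξ : F, ∃ k ∈ A.J, p = (α, ξ • d, A.cross d k, 0)}) := by
  have hB := range_brownEmb h2 hA
  have hJ := range_emb h2 hA
  let I₀ := I.comap A.brownEmb
  have hI₀ : I₀.map A.brownEmb = I :=
    Submodule.map_comap_eq_of_le (hI.1.trans hB.ge)
  have hinner : A.O.herm.IsInner I₀ := by
    refine A.O.herm.isInner_of_forall_tri_self h2 fun e he z => ?_
    obtain ⟨w, rfl⟩ := CubicStructure.skewAct.surjective z
    rw [Submodule.mem_comap, brownEmb_tri_skewAct h2]
    exact sub_mem (I.smul_mem _ (hI.2 _ he _ (hB.le ⟨w, rfl⟩))) (I.smul_mem _ he)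
  have hne : I₀ ≠ ⊤ := fun h => hI' (by rw [← hI₀, h, Submodule.map_top, hB])
  have hfin : Module.finrank F I₀ = 12 := by
    rw [← h12, ← hI₀]
    exact (Submodule.equivMapOfInjective _ A.brownEmb_injective I₀).finrank_eq
  obtain ⟨g, hg, hgI⟩ := OctonionAlgebra.exists_isometry_map_eq_stdIdeal h2 h3 hinner hne
    (by omega)
  obtain ⟨P, hP⟩ := A.brownEmb.exists_leftInverse_of_injective
    (LinearMap.ker_eq_bot.2 A.brownEmb_injective)
  let f : A.Bam →ₗ[F] A.Bam := A.brownEmb ∘ₗ (g : _ →ₗ[F] _) ∘ₗ P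
  have hf : ∀ x, f (A.brownEmb x) = A.brownEmb (g x) := fun x => by
    simp only [f, LinearMap.comp_apply, LinearEquiv.coe_coe]
    rw [show P (A.brownEmb x) = x from LinearMap.congr_fun hP x]
  have hBx : ∀ x ∈ A.Bsub, ∃ y, A.brownEmb y = x := fun x hx => hB.ge hx
  have hBy : ∀ y, A.brownEmb y ∈ A.Bsub := fun y => hB.le ⟨y, rfl⟩
  refine ⟨f, ⟨?_, ?_, ?_⟩, ?_, ?_, A.emb A.O.hermE, hJ.le ⟨_, rfl⟩, ?_, ?_, ?_⟩
  · intro x hx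
    obtain ⟨x, rfl⟩ := hBx x hx
    rw [hf]
    exact hBy _
  · intro x hx y hy h
    obtain ⟨x, rfl⟩ := hBx x hx
    obtain ⟨y, rfl⟩ := hBx y hy
    rw [hf, hf] at h
    rw [g.injective (A.brownEmb_injective h)]
  · intro x hx
    obtain ⟨x, rfl⟩ := hBx x hx
    exact ⟨A.brownEmb (g.symm x), hBy _, by rw [hf, g.apply_symm_apply]⟩
  · intro x hx y hy
    obtain ⟨x, rfl⟩ := hBx x hx
    obtain ⟨y, rfl⟩ := hBx y hy
    rw [hf, hf, bform_brownEmb h2, bform_brownEmb h2, hg.1]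
  · intro x hx y hy z hz
    obtain ⟨x, rfl⟩ := hBx x hx
    obtain ⟨y, rfl⟩ := hBx y hy
    obtain ⟨z, rfl⟩ := hBx z hz
    rw [hf, hf, hf, tform_brownEmb h2, tform_brownEmb h2, hf, hg.2]
  · rw [← map_zero A.emb]
    exact fun h => one_ne_zero (congrArg Prod.fst (A.emb_injective h) : (1 : F) = 0)
  · rw [sharp_emb h2, show A.O.hermSharp A.O.hermE = 0 by
      simp [OctonionAlgebra.hermSharp, OctonionAlgebra.hermE], map_zero]
  · have hX : ∀ k : A.O.Herm, A.O.hermX A.O.hermE k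
        = (0, k.2.2.1, k.2.1, -k.2.2.2.1, 0, 0) := fun k => by
      simp [OctonionAlgebra.hermX_apply, OctonionAlgebra.hermE]
    have him : f '' (I : Set A.Bam) = A.brownEmb '' (A.O.stdIdeal : Set _) := by
      rw [← hgI, ← hI₀, Submodule.map_coe, Submodule.map_coe, Set.image_image, Set.image_image]
      exact Set.image_congr fun x _ => hf x
    rw [him]
    ext p
    constructor
    · rintro ⟨_, ⟨x, rfl⟩, rfl⟩
      refine ⟨x.1, x.2.1, A.emb (0, x.2.2.2.1, x.2.2.1, -x.2.2.2.2, 0, 0), hJ.le ⟨_, rfl⟩, ?_⟩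
      rw [cross_emb h2, hX, ← map_smul, brownEmb_apply]
      simp [OctonionAlgebra.stdIdealMap, OctonionAlgebra.hermE]
    · rintro ⟨α, ξ, k, hk, rfl⟩
      obtain ⟨k, rfl⟩ := hJ.ge hk
      refine ⟨_, ⟨(α, ξ, k.2.2.1, k.2.1, -k.2.2.2.1), rfl⟩, ?_⟩
      rw [cross_emb h2, hX, ← map_smul, brownEmb_apply]
      simp [OctonionAlgebra.stdIdealMap, OctonionAlgebra.hermE]

/-- Every proper inner ideal of a Brown algebra has dimension at most 12;
and over a separably closed field every 12-dimensional proper inner ideal of `B(Jᵈ,F×F)` is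
carried by some isometry of the associated triple system to
`{(α, ξd; d×k, 0) : α,ξ ∈ F, k ∈ Jᵈ}` for some rank-one `d ∈ Jᵈ`. -/
theorem stmt19 {F : Type u} [Field F] (h2 : (2 : F) ≠ 0) (h3 : (3 : F) ≠ 0) :
    (∀ Br : BrownAlgebra F, ∀ I : Submodule F Br.B,
      Br.IsInnerIdealA I → I ≠ ⊤ → Module.finrank F (↥I) ≤ 12) ∧
    (∀ (_ : IsSepClosed F) (A : ReducedAlbert.{u, u} F), A.IsSplitAlbert →
      ∀ I : Submodule F A.Bam, A.IsInnerIdeal 1 I → I ≠ A.Bsub →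
        Module.finrank F (↥I) = 12 →
        ∃ f : A.Bam →ₗ[F] A.Bam,
          Set.BijOn f (A.Bsub : Set A.Bam) (A.Bsub : Set A.Bam) ∧
          (∀ x ∈ A.Bsub, ∀ y ∈ A.Bsub, A.bform 1 (f x) (f y) = A.bform 1 x y) ∧
          (∀ x ∈ A.Bsub, ∀ y ∈ A.Bsub, ∀ z ∈ A.Bsub,
            A.tform 1 (f x) (f y) (f z) = f (A.tform 1 x y z)) ∧
          (∃ d ∈ A.J, d ≠ 0 ∧ A.sharp d = 0 ∧
            f '' (I : Set A.Bam)
              = {p : A.Bam | ∃ α ξ : F, ∃ k ∈ A.J, p = (α, ξ • d, A.cross d k, 0)})) := by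
  refine ⟨fun Br I hI hI' => Br.finrank_le_of_isInnerIdealA h2 h3 hI hI',
    fun _ A hA I hI hI' h12 => ReducedAlbert.exists_isometry_of_isInnerIdeal h2 h3 hA.2 hI hI' h12⟩
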